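/- arXiv:1306.6810 — 4 statements merged into one kernel-verified Lean document; each statement's English description precedes it below -/
import Mathlib

section
/- Let n ≥ 2 and let U ⊆ ℝ^n be open and connected. Suppose g and ḡ are pseudo-Riemannian metrics of class C^3 on U, g is Einstein (i.e., Ric(g)_{ij} = c · g_{ij} on U for some constant c), and g and ḡ are geodesically related via a continuous 1-form ψ that is not identically zero on U. Then ḡ is Einstein, i.e., there exists a constant c̄ such that Ric(ḡ)_{ij} = c̄ · ḡ_{ij} on U. -/
noncomputable section
open scoped BigOperators

/-- Partial derivative `∂_i f` of `f : ℝⁿ → ℝ` in the `i`-th coordinate direction. -/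
def pd {n : ℕ} (i : Fin n) (f : (Fin n → ℝ) → ℝ) (x : Fin n → ℝ) : ℝ :=
  fderiv ℝ f x (Pi.single i 1)

/-- The matrix `(g_{ij}(x))` of a two-index family of functions at a point `x`. -/
def matAt {n : ℕ} (g : Fin n → Fin n → (Fin n → ℝ) → ℝ) (x : Fin n → ℝ) :
    Matrix (Fin n) (Fin n) ℝ := Matrix.of fun i j => g i j x

/-- The components `g^{ij}(x)` of the pointwise inverse matrix. -/
def ginv {n : ℕ} (g : Fin n → Fin n → (Fin n → ℝ) → ℝ) (i j : Fin n) (x : Fin n → ℝ) : ℝ :=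
  (matAt g x)⁻¹ i j

/-- `g` is a pseudo-Riemannian metric of class `C^r` on `U`: the components are
symmetric, of class `C^r`, and the matrix `(g_{ij}(x))` is invertible for every `x ∈ U`. -/
structure IsMetric {n : ℕ} (r : WithTop ℕ∞) (g : Fin n → Fin n → (Fin n → ℝ) → ℝ)
    (U : Set (Fin n → ℝ)) : Prop where
  symm : ∀ i j, ∀ x ∈ U, g i j x = g j i x
  contDiff : ∀ i j, ContDiffOn ℝ r (g i j) U
  inv : ∀ x ∈ U, IsUnit (matAt g x).det

/-- Christoffel symbols `Γ^h_{ij} = (1/2) g^{hk}(∂_i g_{jk} + ∂_j g_{ik} − ∂_k g_{ij})`. -/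
def Christoffel {n : ℕ} (g : Fin n → Fin n → (Fin n → ℝ) → ℝ) (h i j : Fin n)
    (x : Fin n → ℝ) : ℝ :=
  (1/2) * ∑ k, ginv g h k x * (pd i (g j k) x + pd j (g i k) x - pd k (g i j) x)

/-- `g` and `gbar` are geodesically related via the 1-form `ψ`:
`Γ̄^h_{ij} = Γ^h_{ij} + ψ_i δ^h_j + ψ_j δ^h_i` on `U`. -/
def GeodesicallyRelated {n : ℕ} (g gbar : Fin n → Fin n → (Fin n → ℝ) → ℝ)
    (ψ : Fin n → (Fin n → ℝ) → ℝ) (U : Set (Fin n → ℝ)) : Prop :=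
  ∀ h i j, ∀ x ∈ U, Christoffel gbar h i j x =
    Christoffel g h i j x + ψ i x * (if h = j then (1:ℝ) else 0)
      + ψ j x * (if h = i then (1:ℝ) else 0)

/-- Ricci tensor `Ric(g)_{ij} = ∂_α Γ^α_{ij} − ∂_j Γ^α_{iα} + Γ^α_{αβ} Γ^β_{ij} − Γ^α_{jβ} Γ^β_{iα}`. -/
def Ricci {n : ℕ} (g : Fin n → Fin n → (Fin n → ℝ) → ℝ) (i j : Fin n) (x : Fin n → ℝ) : ℝ :=
  (∑ a, pd a (Christoffel g a i j) x) - pd j (fun y => ∑ a, Christoffel g a i a y) x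
    + (∑ a, ∑ b, Christoffel g a a b x * Christoffel g b i j x)
    - (∑ a, ∑ b, Christoffel g a j b x * Christoffel g b i a x)

section PartialDerivatives

variable {n : ℕ} {U : Set (Fin n → ℝ)} {f f' : (Fin n → ℝ) → ℝ} {x : Fin n → ℝ}

theorem differentiableAt_of_contDiffOn {r : WithTop ℕ∞} (hU : IsOpen U) (hf : ContDiffOn ℝ r f U)
    (hr : 1 ≤ r) (hx : x ∈ U) : DifferentiableAt ℝ f x :=
  (hf.contDiffAt (hU.mem_nhds hx)).differentiableAt (by
    rintro rfl
    exact absurd hr (by simp))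

theorem pd_congr (hU : IsOpen U) (hx : x ∈ U) (h : ∀ y ∈ U, f y = f' y) (k : Fin n) :
    pd k f x = pd k f' x := by
  have : f =ᶠ[nhds x] f' := Filter.eventually_of_mem (hU.mem_nhds hx) h
  simp only [pd, this.fderiv_eq]

theorem pd_add (hf : DifferentiableAt ℝ f x) (hf' : DifferentiableAt ℝ f' x) (k : Fin n) :
    pd k (fun y => f y + f' y) x = pd k f x + pd k f' x := by
  simp [pd, fderiv_fun_add hf hf']

theorem pd_neg (k : Fin n) : pd k (fun y => - f y) x = - pd k f x := by
  simp [pd, fderiv_fun_neg]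

theorem pd_sub (hf : DifferentiableAt ℝ f x) (hf' : DifferentiableAt ℝ f' x) (k : Fin n) :
    pd k (fun y => f y - f' y) x = pd k f x - pd k f' x := by
  simp [pd, fderiv_fun_sub hf hf']

theorem pd_mul (hf : DifferentiableAt ℝ f x) (hf' : DifferentiableAt ℝ f' x) (k : Fin n) :
    pd k (fun y => f y * f' y) x = pd k f x * f' x + f x * pd k f' x := by
  simp [pd, fderiv_fun_mul hf hf']
  ring

theorem pd_const_mul (c : ℝ) (hf : DifferentiableAt ℝ f x) (k : Fin n) :
    pd k (fun y => c * f y) x = c * pd k f x := by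
  simp [pd, fderiv_const_mul hf]

theorem pd_const (c : ℝ) (k : Fin n) : pd k (fun _ => c) x = 0 := by
  simp [pd]

theorem pd_sum {ι : Type*} (s : Finset ι) {F : ι → (Fin n → ℝ) → ℝ}
    (hF : ∀ i ∈ s, DifferentiableAt ℝ (F i) x) (k : Fin n) :
    pd k (fun y => ∑ i ∈ s, F i y) x = ∑ i ∈ s, pd k (F i) x := by
  simp [pd, fderiv_fun_sum hF]

theorem contDiffOn_pd {r s : WithTop ℕ∞} (hU : IsOpen U) (hf : ContDiffOn ℝ s f U)
    (hrs : r + 1 ≤ s) (k : Fin n) : ContDiffOn ℝ r (pd k f) U :=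
  (hf.fderiv_of_isOpen hU hrs).clm_apply contDiffOn_const

theorem pd_comm {r : WithTop ℕ∞} (hU : IsOpen U) (hf : ContDiffOn ℝ r f U) (hr : 2 ≤ r)
    (hx : x ∈ U) (k l : Fin n) : pd k (pd l f) x = pd l (pd k f) x := by
  have hc : ContDiffAt ℝ 2 f x := (hf.of_le hr).contDiffAt (hU.mem_nhds hx)
  have hs : IsSymmSndFDerivAt ℝ f x := hc.isSymmSndFDerivAt (by simp)
  have hd : DifferentiableAt ℝ (fderiv ℝ f) x :=
    (hc.fderiv_right (m := 1) (by norm_num)).differentiableAt (by norm_num)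
  have key : ∀ i j : Fin n, pd i (pd j f) x
      = fderiv ℝ (fderiv ℝ f) x (Pi.single i 1) (Pi.single j 1) := by
    intro i j
    unfold pd
    rw [fderiv_clm_apply hd (differentiableAt_const _)]
    simp
  rw [key, key]
  exact hs _ _

/-- The differential is determined by the partial derivatives. -/
theorem fderiv_apply_eq_sum_pd (f : (Fin n → ℝ) → ℝ) (x v : Fin n → ℝ) :
    fderiv ℝ f x v = ∑ k, v k * pd k f x := by
  conv_lhs => rw [pi_eq_sum_univ' v]
  simp only [map_sum, pd]
  refine Finset.sum_congr rfl fun k _ => ?_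
  rw [map_smul, smul_eq_mul]

end PartialDerivatives

section MatrixDerivatives

variable {n : ℕ} {p q s : Type*}

/-- Entrywise partial derivative of a matrix-valued function. -/
def mpd (k : Fin n) (M : (Fin n → ℝ) → Matrix p q ℝ) (x : Fin n → ℝ) : Matrix p q ℝ :=
  Matrix.of fun i j => pd k (fun y => M y i j) x

/-- Entrywise `C^r` regularity of a matrix-valued function. -/
def MatContDiffOn (r : WithTop ℕ∞) (M : (Fin n → ℝ) → Matrix p q ℝ) (U : Set (Fin n → ℝ)) : Prop :=
  ∀ i j, ContDiffOn ℝ r (fun y => M y i j) U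

variable {U : Set (Fin n → ℝ)} {M N : (Fin n → ℝ) → Matrix p q ℝ} {x : Fin n → ℝ}
  {r r' : WithTop ℕ∞}

theorem MatContDiffOn.of_le (hM : MatContDiffOn r M U) (h : r' ≤ r) : MatContDiffOn r' M U :=
  fun i j => (hM i j).of_le h

theorem MatContDiffOn.diff (hM : MatContDiffOn r M U) (hU : IsOpen U) (hr : 1 ≤ r) (hx : x ∈ U)
    (i : p) (j : q) : DifferentiableAt ℝ (fun y => M y i j) x :=
  differentiableAt_of_contDiffOn hU (hM i j) hr hx

theorem MatContDiffOn.add (hM : MatContDiffOn r M U) (hN : MatContDiffOn r N U) :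
    MatContDiffOn r (fun y => M y + N y) U :=
  fun i j => (hM i j).add (hN i j)

theorem MatContDiffOn.sub (hM : MatContDiffOn r M U) (hN : MatContDiffOn r N U) :
    MatContDiffOn r (fun y => M y - N y) U :=
  fun i j => (hM i j).sub (hN i j)

theorem MatContDiffOn.neg (hM : MatContDiffOn r M U) : MatContDiffOn r (fun y => - M y) U :=
  fun i j => (hM i j).neg

theorem MatContDiffOn.transpose (hM : MatContDiffOn r M U) :
    MatContDiffOn r (fun y => (M y).transpose) U :=
  fun i j => hM j i

theorem matContDiffOn_const (A : Matrix p q ℝ) : MatContDiffOn r (fun _ => A) U :=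
  fun _ _ => contDiffOn_const

theorem MatContDiffOn.mul [Fintype q] (hM : MatContDiffOn r M U)
    {N : (Fin n → ℝ) → Matrix q s ℝ} (hN : MatContDiffOn r N U) :
    MatContDiffOn r (fun y => M y * N y) U := by
  intro i j
  simp only [Matrix.mul_apply]
  exact ContDiffOn.sum fun a _ => (hM i a).mul (hN a j)

theorem MatContDiffOn.smul {f : (Fin n → ℝ) → ℝ} (hf : ContDiffOn ℝ r f U)
    (hM : MatContDiffOn r M U) : MatContDiffOn r (fun y => f y • M y) U :=
  fun i j => hf.mul (hM i j)

theorem MatContDiffOn.mpd (hM : MatContDiffOn r M U) (hU : IsOpen U) (h : r' + 1 ≤ r) (k : Fin n) :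
    MatContDiffOn r' (mpd k M) U :=
  fun i j => contDiffOn_pd hU (hM i j) h k

theorem mpd_congr (hU : IsOpen U) (hx : x ∈ U) (h : ∀ y ∈ U, M y = N y) (k : Fin n) :
    mpd k M x = mpd k N x := by
  ext i j
  exact pd_congr hU hx (fun y hy => by rw [h y hy]) k

theorem mpd_transpose (k : Fin n) :
    mpd k (fun y => (M y).transpose) x = (mpd k M x).transpose := rfl

theorem mpd_const (A : Matrix p q ℝ) (k : Fin n) : mpd k (fun _ => A) x = 0 := by
  ext i j
  exact pd_const _ k

theorem mpd_neg (k : Fin n) : mpd k (fun y => - M y) x = - mpd k M x := by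
  ext i j
  exact pd_neg k

theorem mpd_add (hU : IsOpen U) (hx : x ∈ U) (hM : MatContDiffOn 1 M U) (hN : MatContDiffOn 1 N U)
    (k : Fin n) : mpd k (fun y => M y + N y) x = mpd k M x + mpd k N x := by
  ext i j
  exact pd_add (hM.diff hU le_rfl hx i j) (hN.diff hU le_rfl hx i j) k

theorem mpd_sub (hU : IsOpen U) (hx : x ∈ U) (hM : MatContDiffOn 1 M U) (hN : MatContDiffOn 1 N U)
    (k : Fin n) : mpd k (fun y => M y - N y) x = mpd k M x - mpd k N x := by
  ext i j
  exact pd_sub (hM.diff hU le_rfl hx i j) (hN.diff hU le_rfl hx i j) k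

theorem mpd_mul [Fintype q] (hU : IsOpen U) (hx : x ∈ U) (hM : MatContDiffOn 1 M U)
    {N : (Fin n → ℝ) → Matrix q s ℝ} (hN : MatContDiffOn 1 N U) (k : Fin n) :
    mpd k (fun y => M y * N y) x = mpd k M x * N x + M x * mpd k N x := by
  ext i j
  simp only [mpd, Matrix.of_apply, Matrix.add_apply, Matrix.mul_apply]
  rw [pd_sum (F := fun a y => M y i a * N y a j) _
      fun a _ => (hM.diff hU le_rfl hx i a).mul (hN.diff hU le_rfl hx a j),
    ← Finset.sum_add_distrib]
  exact Finset.sum_congr rfl fun a _ =>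
    pd_mul (hM.diff hU le_rfl hx i a) (hN.diff hU le_rfl hx a j) k

theorem mpd_smul {f : (Fin n → ℝ) → ℝ} (hf : DifferentiableAt ℝ f x) (hU : IsOpen U) (hx : x ∈ U)
    (hM : MatContDiffOn 1 M U) (k : Fin n) :
    mpd k (fun y => f y • M y) x = pd k f x • M x + f x • mpd k M x := by
  ext i j
  exact pd_mul hf (hM.diff hU le_rfl hx i j) k

theorem mpd_comm (hU : IsOpen U) (hx : x ∈ U) (hM : MatContDiffOn 2 M U) (k l : Fin n) :
    mpd k (mpd l M) x = mpd l (mpd k M) x := by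
  ext i j
  exact pd_comm hU (hM i j) le_rfl hx k l

end MatrixDerivatives

section Connection

open Matrix

variable {n : ℕ} {U : Set (Fin n → ℝ)} {x : Fin n → ℝ}

/-- The `k`-th coordinate vector, as a column matrix. -/
def coordVec (k : Fin n) : Matrix (Fin n) Unit ℝ := fun i _ => if i = k then 1 else 0

/-- The curvature `R_{kl} = ∂_k Γ_l - ∂_l Γ_k + [Γ_k, Γ_l]` of a connection whose matrices are
`Γ_k = (Γ^i_{kj})_{ij}`. -/
def curv (G : Fin n → (Fin n → ℝ) → Matrix (Fin n) (Fin n) ℝ) (k l : Fin n) (x : Fin n → ℝ) :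
    Matrix (Fin n) (Fin n) ℝ :=
  mpd k (G l) x - mpd l (G k) x + G k x * G l x - G l x * G k x

/-- The covariant derivative `∇_m Λ = ∂_m Λ + [Γ_m, Λ]` of a field of endomorphisms. -/
def covEnd (G : Fin n → (Fin n → ℝ) → Matrix (Fin n) (Fin n) ℝ) (m : Fin n)
    (L : (Fin n → ℝ) → Matrix (Fin n) (Fin n) ℝ) (x : Fin n → ℝ) : Matrix (Fin n) (Fin n) ℝ :=
  mpd m L x + G m x * L x - L x * G m x

/-- The covariant derivative `∇_m R_{kl}` of the curvature. -/
def covCurv (G : Fin n → (Fin n → ℝ) → Matrix (Fin n) (Fin n) ℝ) (m k l : Fin n)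
    (x : Fin n → ℝ) : Matrix (Fin n) (Fin n) ℝ :=
  covEnd G m (curv G k l) x - ∑ a, G m x a k • curv G a l x - ∑ a, G m x a l • curv G k a x

/-- The matrix of the covariant differential `∇ v` of a vector field `v`. -/
def covVec (G : Fin n → (Fin n → ℝ) → Matrix (Fin n) (Fin n) ℝ)
    (v : (Fin n → ℝ) → Matrix (Fin n) Unit ℝ) (x : Fin n → ℝ) : Matrix (Fin n) (Fin n) ℝ :=
  Matrix.of fun i k => (mpd k v x + G k x * v x) i ()

/-- The symmetric bivector `Λu ⊙ w - Λw ⊙ u`. -/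
def wedgeSymm (L : Matrix (Fin n) (Fin n) ℝ) (u w : Matrix (Fin n) Unit ℝ) :
    Matrix (Fin n) (Fin n) ℝ :=
  L * u * wᵀ + w * (L * u)ᵀ - L * w * uᵀ - u * (L * w)ᵀ

theorem mul_coordVec_apply {p : Type*} (M : Matrix p (Fin n) ℝ) (k : Fin n) (i : p) :
    (M * coordVec k) i () = M i k := by
  simp [Matrix.mul_apply, coordVec]

theorem mul_coordVec_eq_sum (M : Matrix (Fin n) (Fin n) ℝ) (k : Fin n) :
    M * coordVec k = ∑ a, M a k • coordVec a := by
  ext i j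
  simp [Matrix.mul_apply, coordVec, Matrix.sum_apply]

theorem covVec_mul_coordVec (G : Fin n → (Fin n → ℝ) → Matrix (Fin n) (Fin n) ℝ)
    (v : (Fin n → ℝ) → Matrix (Fin n) Unit ℝ) (k : Fin n) :
    covVec G v x * coordVec k = mpd k v x + G k x * v x := by
  ext i j
  rw [mul_coordVec_apply]
  rfl

/-- Integrability condition of the linear system `∂_k X = L_k X + X M_k + B_k`. -/
theorem integrability {p q : Type*} [Fintype p] [Fintype q] (hU : IsOpen U) (hx : x ∈ U)
    {X : (Fin n → ℝ) → Matrix p q ℝ} {L : Fin n → (Fin n → ℝ) → Matrix p p ℝ}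
    {M : Fin n → (Fin n → ℝ) → Matrix q q ℝ} {B : Fin n → (Fin n → ℝ) → Matrix p q ℝ}
    (hX : MatContDiffOn 2 X U) (hL : ∀ k, MatContDiffOn 1 (L k) U)
    (hM : ∀ k, MatContDiffOn 1 (M k) U) (hB : ∀ k, MatContDiffOn 1 (B k) U)
    (h : ∀ k, ∀ y ∈ U, mpd k X y = L k y * X y + X y * M k y + B k y) (k l : Fin n) :
    (mpd l (L k) x - mpd k (L l) x + L k x * L l x - L l x * L k x) * X x
      + X x * (mpd l (M k) x - mpd k (M l) x + M l x * M k x - M k x * M l x)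
      + (mpd l (B k) x + L k x * B l x + B l x * M k x)
      - (mpd k (B l) x + L l x * B k x + B k x * M l x) = 0 := by
  have hX1 : MatContDiffOn 1 X U := hX.of_le (by norm_num)
  have key : ∀ i j, mpd j (mpd i X) x = mpd j (L i) x * X x
      + L i x * (L j x * X x + X x * M j x + B j x)
      + ((L j x * X x + X x * M j x + B j x) * M i x + X x * mpd j (M i) x) + mpd j (B i) x := by
    intro i j
    rw [mpd_congr hU hx (h i) j,
      mpd_add hU hx (((hL i).mul hX1).add (hX1.mul (hM i))) (hB i),
      mpd_add hU hx ((hL i).mul hX1) (hX1.mul (hM i)), mpd_mul hU hx (hL i) hX1,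
      mpd_mul hU hx hX1 (hM i), h j x hx]
  have hc := mpd_comm hU hx hX k l
  rw [key, key] at hc
  rw [← sub_eq_zero] at hc
  rw [← neg_eq_zero, ← hc]
  simp only [Matrix.mul_add, Matrix.add_mul, Matrix.mul_sub, Matrix.sub_mul, Matrix.mul_assoc]
  abel

variable {G : Fin n → (Fin n → ℝ) → Matrix (Fin n) (Fin n) ℝ}

theorem matContDiffOn_curv (hU : IsOpen U) (hG : ∀ k, MatContDiffOn 2 (G k) U) (k l : Fin n) :
    MatContDiffOn 1 (curv G k l) U := by
  have hG1 : ∀ k, MatContDiffOn 1 (G k) U := fun k => (hG k).of_le (by norm_num)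
  exact ((((hG l).mpd hU (by norm_num) k).sub ((hG k).mpd hU (by norm_num) l)).add
    ((hG1 k).mul (hG1 l))).sub ((hG1 l).mul (hG1 k))

theorem curv_antisymm (k l : Fin n) : curv G k l x = - curv G l k x := by
  unfold curv
  abel

/-- The curvature of a metric connection is skew. -/
theorem metric_mul_curv (hU : IsOpen U) (hx : x ∈ U) (hG : ∀ k, MatContDiffOn 1 (G k) U)
    {g : (Fin n → ℝ) → Matrix (Fin n) (Fin n) ℝ} (hg : MatContDiffOn 2 g U)
    (hcompat : ∀ k, ∀ y ∈ U, mpd k g y = (G k y)ᵀ * g y + g y * G k y) (k l : Fin n) :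
    g x * curv G k l x + (curv G k l x)ᵀ * g x = 0 := by
  have := integrability hU hx hg (L := fun k y => (G k y)ᵀ) (M := G) (B := fun _ _ => 0)
    (fun k => (hG k).transpose) hG (fun _ => matContDiffOn_const 0)
    (fun k y hy => by rw [hcompat k y hy, add_zero]) l k
  simp only [mpd_transpose, mpd_const, Matrix.mul_zero, Matrix.zero_mul, add_zero, sub_zero] at this
  rw [← this]
  simp only [curv, transpose_add, transpose_sub, transpose_mul]
  abel

/-- Integrability condition of `∇_k a = v ⊙ e_k`. -/
theorem curv_mul_solution (hU : IsOpen U) (hx : x ∈ U) (hG : ∀ k, MatContDiffOn 1 (G k) U)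
    (hsymm : ∀ i j k, ∀ y ∈ U, G k y i j = G j y i k)
    {a : (Fin n → ℝ) → Matrix (Fin n) (Fin n) ℝ} {v : (Fin n → ℝ) → Matrix (Fin n) Unit ℝ}
    (ha : MatContDiffOn 2 a U) (hv : MatContDiffOn 1 v U)
    (heq : ∀ k, ∀ y ∈ U, mpd k a y + G k y * a y + a y * (G k y)ᵀ
      = v y * (coordVec k)ᵀ + coordVec k * (v y)ᵀ) (k l : Fin n) :
    curv G k l x * a x + a x * (curv G k l x)ᵀ
      = wedgeSymm (covVec G v x) (coordVec k) (coordVec l) := by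
  have hB : ∀ k, MatContDiffOn 1 (fun y => v y * (coordVec k)ᵀ + coordVec k * (v y)ᵀ) U :=
    fun k => (hv.mul (matContDiffOn_const _)).add ((matContDiffOn_const _).mul hv.transpose)
  have := integrability hU hx ha (L := fun k y => - G k y) (M := fun k y => -(G k y)ᵀ)
    (fun k => (hG k).neg) (fun k => (hG k).transpose.neg) hB
    (fun k y hy => by rw [← heq k y hy, Matrix.neg_mul, Matrix.mul_neg]; abel) l k
  have hmB : ∀ i j, mpd j (fun y => v y * (coordVec i)ᵀ + coordVec i * (v y)ᵀ) x
      = mpd j v x * (coordVec i)ᵀ + coordVec i * (mpd j v x)ᵀ := by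
    intro i j
    rw [mpd_add hU hx (hv.mul (matContDiffOn_const _)) ((matContDiffOn_const _).mul hv.transpose),
      mpd_mul hU hx hv (matContDiffOn_const _), mpd_mul hU hx (matContDiffOn_const _) hv.transpose,
      mpd_const, mpd_const, mpd_transpose, Matrix.mul_zero, Matrix.zero_mul, add_zero, zero_add]
  have hsw : G k x * coordVec l = G l x * coordVec k := by
    ext i j
    rw [mul_coordVec_apply, mul_coordVec_apply, hsymm i l k x hx]
  have hsw1 : ∀ w : Matrix (Fin n) Unit ℝ,
      w * ((coordVec l)ᵀ * (G k x)ᵀ) = w * ((coordVec k)ᵀ * (G l x)ᵀ) := by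
    intro w
    rw [← transpose_mul, hsw, transpose_mul]
  have hsw2 : ∀ w : Matrix Unit (Fin n) ℝ,
      G k x * (coordVec l * w) = G l x * (coordVec k * w) := by
    intro w
    rw [← Matrix.mul_assoc, hsw, Matrix.mul_assoc]
  simp only [hmB, mpd_neg, mpd_transpose] at this
  rw [wedgeSymm, covVec_mul_coordVec, covVec_mul_coordVec, ← sub_eq_zero, ← neg_eq_zero, ← this]
  simp only [curv, transpose_add, transpose_sub, transpose_mul, Matrix.mul_add, Matrix.add_mul,
    Matrix.mul_sub, Matrix.sub_mul, Matrix.mul_assoc, Matrix.neg_mul, Matrix.mul_neg,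
    hsw1, hsw2]
  abel

/-- Ricci identity for a vector field. -/
theorem curv_mul_vec (hU : IsOpen U) (hx : x ∈ U) (hG : ∀ k, MatContDiffOn 1 (G k) U)
    (hsymm : ∀ i j k, ∀ y ∈ U, G k y i j = G j y i k)
    {v : (Fin n → ℝ) → Matrix (Fin n) Unit ℝ} (hv : MatContDiffOn 2 v U) (k l : Fin n) :
    curv G k l x * v x
      = covEnd G k (covVec G v) x * coordVec l - covEnd G l (covVec G v) x * coordVec k := by
  have hv1 : MatContDiffOn 1 v U := hv.of_le (by norm_num)
  have hL : MatContDiffOn 1 (covVec G v) U := fun i k =>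
    ((hv.mpd hU (by norm_num) k).add ((hG k).mul hv1)) i ()
  have := integrability hU hx hv (L := fun k y => - G k y) (M := fun _ _ => 0)
    (B := fun k y => covVec G v y * coordVec k)
    (fun k => (hG k).neg) (fun _ => matContDiffOn_const 0)
    (fun k => hL.mul (matContDiffOn_const _))
    (fun k y hy => by rw [covVec_mul_coordVec, Matrix.neg_mul, Matrix.mul_zero]; abel) l k
  have hm : ∀ i j : Fin n, mpd j (fun y => covVec G v y * coordVec i) x
      = mpd j (covVec G v) x * coordVec i := by
    intro i j
    rw [mpd_mul hU hx hL (matContDiffOn_const _), mpd_const, Matrix.mul_zero, add_zero]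
  have hsw : G k x * coordVec l = G l x * coordVec k := by
    ext i j
    rw [mul_coordVec_apply, mul_coordVec_apply, hsymm i l k x hx]
  simp only [hm, mpd_neg, mpd_const, Matrix.mul_zero, add_zero, sub_zero] at this
  rw [← sub_eq_zero, ← neg_eq_zero, ← this]
  simp only [curv, covEnd, Matrix.add_mul, Matrix.sub_mul, Matrix.mul_assoc, Matrix.neg_mul,
    Matrix.mul_neg, hsw]
  abel

end Connection

section Bianchi

open Matrix

variable {n : ℕ} {U : Set (Fin n → ℝ)} {x : Fin n → ℝ}
  {G : Fin n → (Fin n → ℝ) → Matrix (Fin n) (Fin n) ℝ}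
  {g : (Fin n → ℝ) → Matrix (Fin n) (Fin n) ℝ}

theorem first_bianchi (hU : IsOpen U) (hx : x ∈ U)
    (hsymm : ∀ i j k, ∀ y ∈ U, G k y i j = G j y i k) (i j k l : Fin n) :
    curv G k l x i j + curv G l j x i k + curv G j k x i l = 0 := by
  have hp : ∀ a b c, mpd a (G b) x i c = mpd a (G c) x i b := fun a b c =>
    pd_congr hU hx (fun y hy => hsymm i c b y hy) a
  have hm : ∀ a b c, (G a x * G b x) i c = (G a x * G c x) i b := fun a b c => by
    simp only [Matrix.mul_apply]
    exact Finset.sum_congr rfl fun d _ => by rw [hsymm d c b x hx]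
  simp only [curv, Matrix.add_apply, Matrix.sub_apply]
  rw [hp k l j, hp l k j, hp j k l, hm k l j, hm l k j, hm j k l]
  ring

theorem cyclic_covEnd_curv (hU : IsOpen U) (hx : x ∈ U) (hG : ∀ k, MatContDiffOn 2 (G k) U)
    (m k l : Fin n) :
    covEnd G m (curv G k l) x + covEnd G k (curv G l m) x + covEnd G l (curv G m k) x = 0 := by
  have hG1 : ∀ k, MatContDiffOn 1 (G k) U := fun k => (hG k).of_le (by norm_num)
  have hd : ∀ a b, MatContDiffOn 1 (mpd a (G b)) U := fun a b => (hG b).mpd hU (by norm_num) a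
  have key : ∀ a b c, mpd a (curv G b c) x = mpd a (mpd b (G c)) x - mpd a (mpd c (G b)) x
      + (mpd a (G b) x * G c x + G b x * mpd a (G c) x)
      - (mpd a (G c) x * G b x + G c x * mpd a (G b) x) := by
    intro a b c
    unfold curv
    rw [mpd_sub hU hx (((hd b c).sub (hd c b)).add ((hG1 b).mul (hG1 c))) ((hG1 c).mul (hG1 b)),
      mpd_add hU hx ((hd b c).sub (hd c b)) ((hG1 b).mul (hG1 c)),
      mpd_sub hU hx (hd b c) (hd c b), mpd_mul hU hx (hG1 b) (hG1 c),
      mpd_mul hU hx (hG1 c) (hG1 b)]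
  simp only [covEnd, key]
  rw [mpd_comm hU hx (hG l) m k, mpd_comm hU hx (hG k) m l, mpd_comm hU hx (hG m) k l]
  simp only [curv]
  noncomm_ring

theorem second_bianchi (hU : IsOpen U) (hx : x ∈ U) (hG : ∀ k, MatContDiffOn 2 (G k) U)
    (hsymm : ∀ i j k, ∀ y ∈ U, G k y i j = G j y i k) (m k l : Fin n) :
    covCurv G m k l x + covCurv G k l m x + covCurv G l m k x = 0 := by
  have hs : ∀ a b c : Fin n, ∑ i, G a x i b • curv G i c x + ∑ i, G b x i a • curv G c i x
      = 0 := by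
    intro a b c
    rw [← Finset.sum_add_distrib]
    refine Finset.sum_eq_zero fun i _ => ?_
    rw [hsymm i a b x hx, curv_antisymm i c, smul_neg, neg_add_cancel]
  have h := cyclic_covEnd_curv hU hx hG m k l
  have h1 := hs m k l
  have h2 := hs k l m
  have h3 := hs l m k
  simp only [covCurv]
  calc _ = (covEnd G m (curv G k l) x + covEnd G k (curv G l m) x + covEnd G l (curv G m k) x)
      - (∑ i, G m x i k • curv G i l x + ∑ i, G k x i m • curv G l i x)
      - (∑ i, G k x i l • curv G i m x + ∑ i, G l x i k • curv G m i x)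
      - (∑ i, G l x i m • curv G i k x + ∑ i, G m x i l • curv G k i x) := by abel
    _ = 0 := by rw [h, h1, h2, h3]; simp

theorem pair_symm_of_curvature_symm {T : Fin n → Fin n → Fin n → Fin n → ℝ}
    (h1 : ∀ i j k l, T i j k l = - T j i k l) (h2 : ∀ i j k l, T i j k l = - T i j l k)
    (h3 : ∀ i j k l, T i j k l + T i k l j + T i l j k = 0) (i j k l : Fin n) :
    T i j k l = T k l i j := by
  linarith [h3 i j k l, h3 j i k l, h3 k i j l, h3 l i j k, h1 i j k l, h1 i k l j, h1 i l j k,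
    h1 j k l i, h1 k l i j, h1 j l i k, h1 l j i k, h1 k j l i, h2 i j k l, h2 i k l j, h2 i l j k,
    h2 j i k l, h2 j k l i, h2 j l i k, h2 k i j l, h2 k j l i, h2 k l i j, h2 l i j k,
    h2 l j k i, h2 l k i j, h1 k i j l, h1 l i j k, h1 l k i j, h1 j k i l, h1 l j k i]

theorem metric_curv_skew (hU : IsOpen U) (hx : x ∈ U) (hG : ∀ k, MatContDiffOn 1 (G k) U)
    (hg : MatContDiffOn 2 g U) (hgs : ∀ y ∈ U, (g y)ᵀ = g y)
    (hcompat : ∀ k, ∀ y ∈ U, mpd k g y = (G k y)ᵀ * g y + g y * G k y) (i j k l : Fin n) :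
    (g x * curv G k l x) i j = - (g x * curv G k l x) j i := by
  have h := congrFun (congrFun (metric_mul_curv hU hx hG hg hcompat k l) i) j
  rw [← hgs x hx, ← transpose_mul, hgs x hx] at h
  simp only [Matrix.add_apply, Matrix.transpose_apply, Matrix.zero_apply] at h
  linarith

theorem metric_curv_bianchi (hU : IsOpen U) (hx : x ∈ U)
    (hsymm : ∀ i j k, ∀ y ∈ U, G k y i j = G j y i k) (i j k l : Fin n) :
    (g x * curv G k l x) i j + (g x * curv G l j x) i k + (g x * curv G j k x) i l = 0 := by
  simp only [Matrix.mul_apply, ← Finset.sum_add_distrib]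
  refine Finset.sum_eq_zero fun a _ => ?_
  rw [← mul_add, ← mul_add, first_bianchi hU hx hsymm, mul_zero]

theorem metric_curv_pair_symm (hU : IsOpen U) (hx : x ∈ U) (hG : ∀ k, MatContDiffOn 1 (G k) U)
    (hsymm : ∀ i j k, ∀ y ∈ U, G k y i j = G j y i k)
    (hg : MatContDiffOn 2 g U) (hgs : ∀ y ∈ U, (g y)ᵀ = g y)
    (hcompat : ∀ k, ∀ y ∈ U, mpd k g y = (G k y)ᵀ * g y + g y * G k y) (i j k l : Fin n) :
    (g x * curv G k l x) i j = (g x * curv G i j x) k l :=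
  pair_symm_of_curvature_symm (T := fun i j k l => (g x * curv G k l x) i j)
    (fun i j k l => metric_curv_skew hU hx hG hg hgs hcompat i j k l)
    (fun i j k l => by rw [curv_antisymm k l, Matrix.mul_neg, Matrix.neg_apply])
    (fun i j k l => metric_curv_bianchi hU hx hsymm i j k l) i j k l

/-- Covariant differentiation commutes with lowering an index of the curvature. -/
theorem metric_covCurv_apply (hU : IsOpen U) (hx : x ∈ U) (hG : ∀ k, MatContDiffOn 2 (G k) U)
    (hg : MatContDiffOn 2 g U)
    (hcompat : ∀ k, ∀ y ∈ U, mpd k g y = (G k y)ᵀ * g y + g y * G k y) (m i j k l : Fin n) :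
    (g x * covCurv G m k l x) i j = pd m (fun y => (g y * curv G k l y) i j) x
      - ∑ a, G m x a i * (g x * curv G k l x) a j - ∑ a, G m x a j * (g x * curv G k l x) i a
      - ∑ a, G m x a k * (g x * curv G a l x) i j - ∑ a, G m x a l * (g x * curv G k a x) i j := by
  have hp : pd m (fun y => (g y * curv G k l y) i j) x
      = (mpd m g x * curv G k l x + g x * mpd m (curv G k l) x) i j := by
    rw [← mpd_mul hU hx (hg.of_le (by norm_num)) (matContDiffOn_curv hU hG k l)]
    rfl
  have e1 : ∑ a, G m x a i * (g x * curv G k l x) a j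
      = ((G m x)ᵀ * (g x * curv G k l x)) i j := by simp [Matrix.mul_apply]
  have e2 : ∑ a, G m x a j * (g x * curv G k l x) i a
      = ((g x * curv G k l x) * G m x) i j := by
    rw [Matrix.mul_apply]
    exact Finset.sum_congr rfl fun a _ => mul_comm _ _
  have e3 : ∑ a, G m x a k * (g x * curv G a l x) i j
      = (g x * ∑ a, G m x a k • curv G a l x) i j := by
    simp [Matrix.mul_sum, Matrix.sum_apply]
  have e4 : ∑ a, G m x a l * (g x * curv G k a x) i j
      = (g x * ∑ a, G m x a l • curv G k a x) i j := by
    simp [Matrix.mul_sum, Matrix.sum_apply]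
  rw [hp, e1, e2, e3, e4, hcompat m x hx]
  simp only [← Matrix.sub_apply]
  simp only [covCurv, covEnd, Matrix.mul_add, Matrix.add_mul, Matrix.mul_sub, Matrix.mul_assoc]
  abel_nf

theorem metric_covCurv_pair_symm (hU : IsOpen U) (hx : x ∈ U)
    (hG : ∀ k, MatContDiffOn 2 (G k) U) (hsymm : ∀ i j k, ∀ y ∈ U, G k y i j = G j y i k)
    (hg : MatContDiffOn 2 g U) (hgs : ∀ y ∈ U, (g y)ᵀ = g y)
    (hcompat : ∀ k, ∀ y ∈ U, mpd k g y = (G k y)ᵀ * g y + g y * G k y) (m i j k l : Fin n) :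
    (g x * covCurv G m k l x) i j = (g x * covCurv G m i j x) k l := by
  have hps : ∀ i j k l, ∀ y ∈ U, (g y * curv G k l y) i j = (g y * curv G i j y) k l :=
    fun i j k l y hy => metric_curv_pair_symm hU hy (fun k => (hG k).of_le (by norm_num)) hsymm
      hg hgs hcompat i j k l
  rw [metric_covCurv_apply hU hx hG hg hcompat, metric_covCurv_apply hU hx hG hg hcompat,
    pd_congr hU hx (hps i j k l) m]
  have s1 : ∀ a, (g x * curv G k l x) a j = (g x * curv G a j x) k l := fun a => hps a j k l x hx
  have s2 : ∀ a, (g x * curv G k l x) i a = (g x * curv G i a x) k l := fun a => hps i a k l x hx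
  have s3 : ∀ a, (g x * curv G a l x) i j = (g x * curv G i j x) a l := fun a => hps i j a l x hx
  have s4 : ∀ a, (g x * curv G k a x) i j = (g x * curv G i j x) k a := fun a => hps i j k a x hx
  simp only [s1, s2, s3, s4]
  ring

/-- The Ricci tensor of an Einstein metric is parallel. -/
theorem trace_covCurv (hU : IsOpen U) (hx : x ∈ U) (hG : ∀ k, MatContDiffOn 2 (G k) U)
    (hg : MatContDiffOn 2 g U)
    (hcompat : ∀ k, ∀ y ∈ U, mpd k g y = (G k y)ᵀ * g y + g y * G k y) {c : ℝ}
    (hRic : ∀ j l, ∀ y ∈ U, ∑ i, curv G i l y i j = c * g y j l) (m j l : Fin n) :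
    ∑ i, covCurv G m i l x i j = 0 := by
  have hC : ∀ k l, MatContDiffOn 1 (curv G k l) U := matContDiffOn_curv hU hG
  have hp : ∑ i, mpd m (curv G i l) x i j = c * mpd m g x j l := by
    have h := pd_congr hU hx (hRic j l) m
    rw [pd_const_mul _ ((hg.of_le (by norm_num) : MatContDiffOn 1 g U).diff hU le_rfl hx j l),
      pd_sum (F := fun i y => curv G i l y i j) _ fun i _ => (hC i l).diff hU le_rfl hx i j] at h
    exact h
  have e1 : ∑ i, (curv G i l x * G m x) i j = c * ((G m x)ᵀ * g x) j l := by
    simp only [Matrix.mul_apply, Matrix.transpose_apply]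
    rw [Finset.sum_comm, Finset.mul_sum]
    refine Finset.sum_congr rfl fun a _ => ?_
    rw [← Finset.sum_mul, hRic a l x hx]
    ring
  have e2 : ∑ i, ∑ a, G m x a l * curv G i a x i j = c * (g x * G m x) j l := by
    simp only [Matrix.mul_apply]
    rw [Finset.sum_comm, Finset.mul_sum]
    refine Finset.sum_congr rfl fun a _ => ?_
    rw [← Finset.mul_sum, hRic j a x hx]
    ring
  have e3 : ∑ i, (G m x * curv G i l x) i j = ∑ i, ∑ a, G m x a i * curv G a l x i j := by
    simp only [Matrix.mul_apply]
    rw [Finset.sum_comm]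
  simp only [covCurv, covEnd, Matrix.add_apply, Matrix.sub_apply, Matrix.sum_apply,
    Matrix.smul_apply, smul_eq_mul, Finset.sum_add_distrib, Finset.sum_sub_distrib]
  rw [hp, e1, e2, e3, hcompat m x hx, Matrix.add_apply]
  ring

/-- The curvature of an Einstein metric is divergence free. -/
theorem divergence_covCurv (hU : IsOpen U) (hx : x ∈ U) (hG : ∀ k, MatContDiffOn 2 (G k) U)
    (hsymm : ∀ i j k, ∀ y ∈ U, G k y i j = G j y i k)
    (hg : MatContDiffOn 2 g U) (hgs : ∀ y ∈ U, (g y)ᵀ = g y)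
    (hcompat : ∀ k, ∀ y ∈ U, mpd k g y = (G k y)ᵀ * g y + g y * G k y) {c : ℝ}
    (hRic : ∀ j l, ∀ y ∈ U, ∑ i, curv G i l y i j = c * g y j l)
    {h : Matrix (Fin n) (Fin n) ℝ} (hh : h * g x = 1) (i j k : Fin n) :
    ∑ m, ∑ l, h m l * (g x * covCurv G m l k x) i j = 0 := by
  have e : ∀ m, ∑ l, h m l * (g x * covCurv G m l k x) i j = covCurv G m i j x m k := by
    intro m
    calc _ = ∑ l, h m l * (g x * covCurv G m i j x) l k :=
          Finset.sum_congr rfl fun l _ => by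
            rw [metric_covCurv_pair_symm hU hx hG hsymm hg hgs hcompat]
      _ = (h * (g x * covCurv G m i j x)) m k := by rw [Matrix.mul_apply]
      _ = _ := by rw [← Matrix.mul_assoc, hh, Matrix.one_mul]
  simp only [e]
  have hb : ∀ m, covCurv G m i j x m k = - covCurv G i j m x m k - covCurv G j m i x m k := by
    intro m
    have := congrFun (congrFun (second_bianchi hU hx hG hsymm m i j) m) k
    simp only [Matrix.add_apply, Matrix.zero_apply] at this
    linarith
  have ha : ∀ m, covCurv G i j m x m k = - covCurv G i m j x m k := by
    intro m
    have : covCurv G i j m x = - covCurv G i m j x := by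
      have hc : covEnd G i (curv G j m) x = - covEnd G i (curv G m j) x := by
        have : curv G j m = fun y => - curv G m j y := funext fun y => curv_antisymm j m
        rw [this]
        simp only [covEnd, mpd_neg]
        noncomm_ring
      have h1 : ∀ a, curv G a m x = - curv G m a x := fun a => curv_antisymm a m
      have h2 : ∀ a, curv G j a x = - curv G a j x := fun a => curv_antisymm j a
      simp only [covCurv, hc, h1, h2, smul_neg, Finset.sum_neg_distrib]
      abel
    rw [this, Matrix.neg_apply]
  simp only [hb, ha, neg_neg, Finset.sum_sub_distrib, trace_covCurv hU hx hG hg hcompat hRic,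
    sub_zero]

end Bianchi

section Prolongation

open Matrix

variable {n : ℕ} {U : Set (Fin n → ℝ)} {x : Fin n → ℝ}
  {G : Fin n → (Fin n → ℝ) → Matrix (Fin n) (Fin n) ℝ}
  {g a : (Fin n → ℝ) → Matrix (Fin n) (Fin n) ℝ} {v : (Fin n → ℝ) → Matrix (Fin n) Unit ℝ}

theorem matContDiffOn_covVec (hU : IsOpen U) (hG : ∀ k, MatContDiffOn 1 (G k) U)
    (hv : MatContDiffOn 2 v U) : MatContDiffOn 1 (covVec G v) U := fun i k =>
  ((hv.mpd hU (by norm_num) k).add ((hG k).mul (hv.of_le (by norm_num)))) i ()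

theorem sum_smul_wedgeSymm_left {ι : Type*} [Fintype ι] (L : Matrix (Fin n) (Fin n) ℝ)
    (f : ι → ℝ) (u : ι → Matrix (Fin n) Unit ℝ) (w : Matrix (Fin n) Unit ℝ) :
    ∑ i, f i • wedgeSymm L (u i) w = wedgeSymm L (∑ i, f i • u i) w := by
  simp only [wedgeSymm, Matrix.mul_sum, Matrix.sum_mul, transpose_sum, Matrix.mul_smul,
    Matrix.smul_mul, transpose_smul, smul_add, smul_sub, Finset.sum_add_distrib,
    Finset.sum_sub_distrib]

theorem wedgeSymm_swap (L : Matrix (Fin n) (Fin n) ℝ) (u w : Matrix (Fin n) Unit ℝ) :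
    wedgeSymm L u w = - wedgeSymm L w u := by
  unfold wedgeSymm
  abel

/-- The covariant derivative of the integrability condition `curv_mul_solution`. -/
theorem covCurv_mul_solution (hU : IsOpen U) (hx : x ∈ U) (hG : ∀ k, MatContDiffOn 2 (G k) U)
    (hsymm : ∀ i j k, ∀ y ∈ U, G k y i j = G j y i k)
    (ha : MatContDiffOn 2 a U) (hv : MatContDiffOn 2 v U)
    (heq : ∀ k, ∀ y ∈ U, mpd k a y + G k y * a y + a y * (G k y)ᵀ
      = v y * (coordVec k)ᵀ + coordVec k * (v y)ᵀ) (m l k : Fin n) :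
    covCurv G m l k x * a x + a x * (covCurv G m l k x)ᵀ
      + curv G l k x * (v x * (coordVec m)ᵀ + coordVec m * (v x)ᵀ)
      + (v x * (coordVec m)ᵀ + coordVec m * (v x)ᵀ) * (curv G l k x)ᵀ
      = wedgeSymm (covEnd G m (covVec G v) x) (coordVec l) (coordVec k) := by
  have hG1 : ∀ k, MatContDiffOn 1 (G k) U := fun k => (hG k).of_le (by norm_num)
  have ha1 : MatContDiffOn 1 a U := ha.of_le (by norm_num)
  have hv1 : MatContDiffOn 1 v U := hv.of_le (by norm_num)
  have hL := matContDiffOn_covVec hU hG1 hv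
  have hR := matContDiffOn_curv hU hG l k
  have hW : ∀ l k, ∀ y ∈ U, curv G l k y * a y + a y * (curv G l k y)ᵀ
      = wedgeSymm (covVec G v y) (coordVec l) (coordVec k) := fun l k y hy =>
    curv_mul_solution hU hy hG1 hsymm ha hv1 heq l k
  have hc : ∀ l : Fin n, MatContDiffOn 1 (fun _ : Fin n → ℝ => coordVec l) U := fun l =>
    matContDiffOn_const _
  have hLc : ∀ l : Fin n, MatContDiffOn 1 (fun y => covVec G v y * coordVec l) U := fun l =>
    hL.mul (hc l)
  have hLcm : ∀ l : Fin n, mpd m (fun y => covVec G v y * coordVec l) x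
      = mpd m (covVec G v) x * coordVec l := by
    intro l
    rw [mpd_mul hU hx hL (hc l), mpd_const, Matrix.mul_zero, add_zero]
  have hterm : ∀ l k : Fin n, MatContDiffOn 1 (fun y => covVec G v y * coordVec l * (coordVec k)ᵀ) U
      ∧ mpd m (fun y => covVec G v y * coordVec l * (coordVec k)ᵀ) x
        = mpd m (covVec G v) x * coordVec l * (coordVec k)ᵀ := by
    intro l k
    refine ⟨(hLc l).mul (hc k).transpose, ?_⟩
    rw [mpd_mul hU hx (hLc l) (hc k).transpose, hLcm, mpd_const, Matrix.mul_zero, add_zero]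
  have hterm' : ∀ l k : Fin n,
      MatContDiffOn 1 (fun y => coordVec k * (covVec G v y * coordVec l)ᵀ) U
      ∧ mpd m (fun y => coordVec k * (covVec G v y * coordVec l)ᵀ) x
        = coordVec k * (mpd m (covVec G v) x * coordVec l)ᵀ := by
    intro l k
    refine ⟨(hc k).mul (hLc l).transpose, ?_⟩
    rw [mpd_mul hU hx (hc k) (hLc l).transpose, mpd_const, Matrix.zero_mul, zero_add,
      mpd_transpose, hLcm]
  have hd := mpd_congr hU hx (hW l k) m
  rw [mpd_add hU hx (hR.mul ha1) (ha1.mul hR.transpose), mpd_mul hU hx hR ha1,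
    mpd_mul hU hx ha1 hR.transpose, mpd_transpose] at hd
  have hdW : mpd m (fun y => wedgeSymm (covVec G v y) (coordVec l) (coordVec k)) x
      = wedgeSymm (mpd m (covVec G v) x) (coordVec l) (coordVec k) := by
    unfold wedgeSymm
    rw [mpd_sub hU hx (((hterm l k).1.add (hterm' l k).1).sub (hterm k l).1) (hterm' k l).1,
      mpd_sub hU hx ((hterm l k).1.add (hterm' l k).1) (hterm k l).1,
      mpd_add hU hx (hterm l k).1 (hterm' l k).1, (hterm l k).2, (hterm' l k).2, (hterm k l).2,
      (hterm' k l).2]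
  rw [hdW] at hd
  have hs1 : (∑ i, G m x i l • curv G i k x) * a x + a x * (∑ i, G m x i l • curv G i k x)ᵀ
      = wedgeSymm (covVec G v x) (G m x * coordVec l) (coordVec k) := by
    rw [mul_coordVec_eq_sum, ← sum_smul_wedgeSymm_left]
    simp only [Matrix.mul_sum, Matrix.sum_mul, transpose_sum, Matrix.mul_smul,
      Matrix.smul_mul, transpose_smul, ← Finset.sum_add_distrib, ← smul_add, hW _ _ x hx]
  have hs2 : (∑ i, G m x i k • curv G l i x) * a x + a x * (∑ i, G m x i k • curv G l i x)ᵀ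
      = wedgeSymm (covVec G v x) (coordVec l) (G m x * coordVec k) := by
    rw [mul_coordVec_eq_sum, wedgeSymm_swap, ← sum_smul_wedgeSymm_left, ← Finset.sum_neg_distrib]
    simp only [Matrix.mul_sum, Matrix.sum_mul, transpose_sum, Matrix.mul_smul,
      Matrix.smul_mul, transpose_smul, ← Finset.sum_add_distrib, ← smul_add, hW _ _ x hx,
      ← smul_neg, ← wedgeSymm_swap]
  have hma : mpd m a x = v x * (coordVec m)ᵀ + coordVec m * (v x)ᵀ
      - G m x * a x - a x * (G m x)ᵀ := by
    rw [← heq m x hx]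
    abel
  have hWx := hW l k x hx
  calc _ = (mpd m (curv G l k) x * a x + curv G l k x * mpd m a x
        + (mpd m a x * (curv G l k x)ᵀ + a x * (mpd m (curv G l k) x)ᵀ))
      + G m x * (curv G l k x * a x + a x * (curv G l k x)ᵀ)
      + (curv G l k x * a x + a x * (curv G l k x)ᵀ) * (G m x)ᵀ
      - ((∑ i, G m x i l • curv G i k x) * a x + a x * (∑ i, G m x i l • curv G i k x)ᵀ)
      - ((∑ i, G m x i k • curv G l i x) * a x + a x * (∑ i, G m x i k • curv G l i x)ᵀ) := by
        rw [hma]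
        simp only [covCurv, covEnd, transpose_add, transpose_sub, transpose_mul, Matrix.mul_add,
          Matrix.add_mul, Matrix.mul_sub, Matrix.sub_mul, Matrix.mul_assoc]
        abel
    _ = _ := by
        rw [hd, hWx, hs1, hs2]
        simp only [wedgeSymm, covEnd, transpose_add, transpose_sub, transpose_mul, Matrix.mul_add,
          Matrix.add_mul, Matrix.mul_sub, Matrix.sub_mul, Matrix.mul_assoc]
        abel

end Prolongation

section EinsteinSystem

open Matrix

variable {n : ℕ} {U : Set (Fin n → ℝ)} {x : Fin n → ℝ} {c : ℝ}
  {G : Fin n → (Fin n → ℝ) → Matrix (Fin n) (Fin n) ℝ}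
  {g a : (Fin n → ℝ) → Matrix (Fin n) (Fin n) ℝ} {v : (Fin n → ℝ) → Matrix (Fin n) Unit ℝ}

/-- A symmetric solution `a`, with associated vector field `v`, of the linear equation
`∇_k a = v ⊙ e_k` of geodesic mappings, on an Einstein manifold with metric `g`, Levi-Civita
connection `G` and Einstein constant `c`. -/
structure EinsteinGeodesicSystem (U : Set (Fin n → ℝ))
    (G : Fin n → (Fin n → ℝ) → Matrix (Fin n) (Fin n) ℝ)
    (g a : (Fin n → ℝ) → Matrix (Fin n) (Fin n) ℝ) (v : (Fin n → ℝ) → Matrix (Fin n) Unit ℝ)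
    (c : ℝ) : Prop where
  isOpen : IsOpen U
  conn_contDiff : ∀ k, MatContDiffOn 2 (G k) U
  conn_symm : ∀ i j k, ∀ y ∈ U, G k y i j = G j y i k
  metric_contDiff : MatContDiffOn 2 g U
  metric_symm : ∀ y ∈ U, (g y)ᵀ = g y
  metric_isUnit : ∀ y ∈ U, IsUnit (g y).det
  compat : ∀ k, ∀ y ∈ U, mpd k g y = (G k y)ᵀ * g y + g y * G k y
  einstein : ∀ j l, ∀ y ∈ U, ∑ i, curv G i l y i j = c * g y j l
  sol_contDiff : MatContDiffOn 2 a U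
  sol_symm : ∀ y ∈ U, (a y)ᵀ = a y
  vec_contDiff : MatContDiffOn 2 v U
  sol_eq : ∀ k, ∀ y ∈ U, mpd k a y + G k y * a y + a y * (G k y)ᵀ
      = v y * (coordVec k)ᵀ + coordVec k * (v y)ᵀ

theorem wedgeSymm_coordVec_apply (M L N : Matrix (Fin n) (Fin n) ℝ) (l k i j : Fin n) :
    (M * wedgeSymm L (coordVec l) (coordVec k) * N) i j
      = (M * L) i l * N k j + M i k * (Nᵀ * L) j l - (M * L) i k * N l j
        - M i l * (Nᵀ * L) j k := by
  have h : ∀ (A B : Matrix (Fin n) (Fin n) ℝ) (u w : Fin n),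
      (A * coordVec u * (coordVec w)ᵀ * B) i j = A i u * B w j := by
    intro A B u w
    have e : (coordVec w)ᵀ * B = (Bᵀ * coordVec w)ᵀ := by simp [transpose_mul]
    rw [Matrix.mul_assoc _ _ B, e, Matrix.mul_apply, Fintype.sum_unique, Matrix.transpose_apply]
    exact congrArg₂ (· * ·) (mul_coordVec_apply A u i) (mul_coordVec_apply Bᵀ w j)
  have e1 := h (M * L) N l k
  have e2 := h M (Lᵀ * N) k l
  have e3 := h (M * L) N k l
  have e4 := h M (Lᵀ * N) l k
  have et : ∀ u, (Nᵀ * L) j u = (Lᵀ * N) u j := fun u => by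
    rw [← Matrix.transpose_apply (Nᵀ * L), transpose_mul, transpose_transpose]
  rw [et, et, ← e1, ← e2, ← e3, ← e4]
  simp only [wedgeSymm, transpose_mul, Matrix.mul_add, Matrix.mul_sub, Matrix.add_mul,
    Matrix.sub_mul, Matrix.mul_assoc, Matrix.add_apply, Matrix.sub_apply]

/-- The algebraic solution of the contracted prolongation equations. -/
theorem solve_contracted_prolongation {h g : Matrix (Fin n) (Fin n) ℝ} (hs : hᵀ = h)
    (gs : gᵀ = g) (hg : h * g = 1) {T S : Fin n → Fin n → Fin n → ℝ} {w D : Fin n → ℝ} {K : ℝ}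
    (hn : 2 ≤ n)
    (hT : ∀ p q k, T p q k = - T p k q) (hS : ∀ p q k, S p q k = S p k q)
    (hTtr : ∀ l, ∑ j, ∑ k, h j k * T j k l = (n - 1) * K * w l)
    (hD : ∀ p, ∑ m, ∑ l, h m l * S m p l = D p)
    (hB : ∀ p q k, T p q k + T q p k - (n - 1) * K * (g p k * w q + g q k * w p)
      = D p * g k q + g p k * D q - S q p k - S p q k)
    (hC : ∀ j k l, T j k l = S k j l - S l j k) (p q k : Fin n) :
    S p q k = - K * (2 * w p * g q k + w q * g p k + w k * g p q)
      ∧ T p q k = K * (g p q * w k - g p k * w q) := by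
  have hn1 : (n : ℝ) - 1 ≠ 0 := by
    have : (2 : ℝ) ≤ n := by exact_mod_cast hn
    linarith
  have gsy : ∀ i j, g i j = g j i := fun i j => congrFun (congrFun gs j) i
  have hsy : ∀ i j, h i j = h j i := fun i j => congrFun (congrFun hs j) i
  have hgd : ∀ i j, ∑ k, h i k * g k j = if i = j then 1 else 0 := fun i j => by
    rw [← Matrix.mul_apply, hg, Matrix.one_apply]
  have hDval : ∀ q, D q = - (n + 3) * K * w q := by
    intro q
    have t1 : ∑ p, ∑ k, h p k * T p q k = - ((n - 1) * K * w q) := by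
      rw [← hTtr q, ← Finset.sum_neg_distrib]
      refine Finset.sum_congr rfl fun p _ => ?_
      rw [← Finset.sum_neg_distrib]
      exact Finset.sum_congr rfl fun k _ => by rw [hT p q k]; ring
    have t2 : ∑ p, ∑ k, h p k * T q p k = 0 := by
      have e : ∑ p, ∑ k, h p k * T q p k = - ∑ p, ∑ k, h p k * T q p k := by
        conv_lhs => rw [Finset.sum_comm]
        rw [← Finset.sum_neg_distrib]
        refine Finset.sum_congr rfl fun p _ => ?_
        rw [← Finset.sum_neg_distrib]
        exact Finset.sum_congr rfl fun k _ => by rw [hT q k p, hsy k p]; ring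
      linarith
    have t3 : ∀ r : ℝ, ∑ p, ∑ k, h p k * (g p k * r) = n * r := fun r => by
      have : ∀ p, ∑ k, h p k * (g p k * r) = r := fun p => by
        have := hgd p p
        simp only [if_true] at this
        calc _ = (∑ k, h p k * g k p) * r := by
              rw [Finset.sum_mul]
              exact Finset.sum_congr rfl fun k _ => by rw [gsy p k]; ring
          _ = _ := by rw [this, one_mul]
      simp [this]
    have t4 : ∀ f : Fin n → ℝ, ∑ p, ∑ k, h p k * (g q k * f p) = f q := fun f => by
      have : ∀ p, ∑ k, h p k * (g q k * f p) = if p = q then f p else 0 := fun p => by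
        calc _ = (∑ k, h p k * g k q) * f p := by
              rw [Finset.sum_mul]
              exact Finset.sum_congr rfl fun k _ => by rw [gsy q k]; ring
          _ = _ := by rw [hgd]; simp
      simp [this]
    have t5 : ∑ p, ∑ k, h p k * S p q k = D q := hD q
    have t6 : ∑ j, ∑ k, h j k * S k j q = D q := by
      rw [← hD q, Finset.sum_comm]
      exact Finset.sum_congr rfl fun j _ => Finset.sum_congr rfl fun k _ => by
        rw [hsy, hS j k q]
    have hBs : ∑ p, ∑ k, (h p k * T p q k + h p k * T q p k
        - (n - 1) * K * (h p k * (g p k * w q) + h p k * (g q k * w p)))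
        = ∑ p, ∑ k, (h p k * (g q k * D p) + h p k * (g p k * D q) - h p k * S q p k
          - h p k * S p q k) :=
      Finset.sum_congr rfl fun p _ => Finset.sum_congr rfl fun k _ => by
        have := hB p q k
        rw [gsy k q] at this
        linear_combination h p k * this
    have hCs : ∑ j, ∑ k, h j k * T j k q = ∑ j, ∑ k, (h j k * S k j q - h j k * S q j k) :=
      Finset.sum_congr rfl fun p _ => Finset.sum_congr rfl fun k _ => by rw [hC]; ring
    simp only [Finset.sum_add_distrib, Finset.sum_sub_distrib, ← Finset.mul_sum] at hBs hCs
    rw [t1, t2, t3, t3, t4, t4, t5] at hBs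
    rw [hTtr, t6] at hCs
    apply mul_left_cancel₀ hn1
    linear_combination hCs - hBs
  have e : ∀ p q k, S q p k + S p q k - S k p q = -2 * K * (g p k * w q + g q k * w p) := by
    intro p q k
    have := hB p q k
    rw [hDval, hDval, gsy k q, hC p q k, hC q p k, hS k q p] at this
    linarith
  have hSv : ∀ p q k, S p q k = - K * (2 * w p * g q k + w q * g p k + w k * g p q) := by
    intro p q k
    have e1 := e p q k
    have e2 := e p k q
    rw [gsy k q, hS p k q] at e2
    linarith
  refine ⟨hSv p q k, ?_⟩
  rw [hC, hSv, hSv, gsy q p, gsy k p, gsy k q]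
  ring

end EinsteinSystem

namespace EinsteinGeodesicSystem

open Matrix

variable {n : ℕ} {U : Set (Fin n → ℝ)} {x : Fin n → ℝ} {c : ℝ}
  {G : Fin n → (Fin n → ℝ) → Matrix (Fin n) (Fin n) ℝ}
  {g a : (Fin n → ℝ) → Matrix (Fin n) (Fin n) ℝ} {v : (Fin n → ℝ) → Matrix (Fin n) Unit ℝ}

theorem conn_contDiff_one (H : EinsteinGeodesicSystem U G g a v c) (k : Fin n) :
    MatContDiffOn 1 (G k) U := (H.conn_contDiff k).of_le (by norm_num)

theorem curv_skew (H : EinsteinGeodesicSystem U G g a v c) (hx : x ∈ U) (i j k l : Fin n) :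
    (g x * curv G k l x) i j = - (g x * curv G k l x) j i :=
  metric_curv_skew H.isOpen hx H.conn_contDiff_one H.metric_contDiff H.metric_symm H.compat i j k l

theorem curv_pair_symm (H : EinsteinGeodesicSystem U G g a v c) (hx : x ∈ U) (i j k l : Fin n) :
    (g x * curv G k l x) i j = (g x * curv G i j x) k l :=
  metric_curv_pair_symm H.isOpen hx H.conn_contDiff_one H.conn_symm H.metric_contDiff
    H.metric_symm H.compat i j k l

theorem curv_sol (H : EinsteinGeodesicSystem U G g a v c) (hx : x ∈ U) (k l : Fin n) :
    curv G k l x * a x + a x * (curv G k l x)ᵀ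
      = wedgeSymm (covVec G v x) (coordVec k) (coordVec l) :=
  curv_mul_solution H.isOpen hx H.conn_contDiff_one H.conn_symm H.sol_contDiff
    (H.vec_contDiff.of_le (by norm_num)) H.sol_eq k l

theorem covVec_contDiff (H : EinsteinGeodesicSystem U G g a v c) :
    MatContDiffOn 1 (covVec G v) U :=
  matContDiffOn_covVec H.isOpen H.conn_contDiff_one H.vec_contDiff

/-- The trace of the integrability condition determines `∇ v`. -/
theorem trace_curv_sol (H : EinsteinGeodesicSystem U G g a v c) (hx : x ∈ U) (j l : Fin n) :
    n * covVec G v x j l = (covVec G v x).trace * (1 : Matrix (Fin n) (Fin n) ℝ) j l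
      - c * (a x * g x) j l + ∑ k, ∑ b, a x k b * curv G l k x j b := by
  have h : ∀ k, (curv G l k x * a x) k j + (a x * (curv G l k x)ᵀ) k j
      = wedgeSymm (covVec G v x) (coordVec l) (coordVec k) k j := fun k => by
    rw [← H.curv_sol hx l k, Matrix.add_apply]
  have hw : ∀ k, wedgeSymm (covVec G v x) (coordVec l) (coordVec k) k j
      = covVec G v x k l * (1 : Matrix (Fin n) (Fin n) ℝ) k j + covVec G v x j l
        - covVec G v x k k * (1 : Matrix (Fin n) (Fin n) ℝ) l j
        - (1 : Matrix (Fin n) (Fin n) ℝ) k l * covVec G v x j k := fun k => by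
    have := wedgeSymm_coordVec_apply 1 (covVec G v x) 1 l k k j
    simpa using this
  have e1 : ∑ k, (curv G l k x * a x) k j = - c * (a x * g x) j l := by
    simp only [Matrix.mul_apply]
    rw [Finset.sum_comm, Finset.mul_sum]
    refine Finset.sum_congr rfl fun b _ => ?_
    have h2 : ∑ k, curv G l k x k b = - (c * g x b l) := by
      rw [← H.einstein b l x hx, ← Finset.sum_neg_distrib]
      exact Finset.sum_congr rfl fun k _ => by rw [curv_antisymm l k, Matrix.neg_apply]
    have h3 : a x b j = a x j b := congrFun (congrFun (H.sol_symm x hx) j) b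
    rw [← Finset.sum_mul, h2, h3]
    ring
  have e2 : ∑ k, (a x * (curv G l k x)ᵀ) k j = ∑ k, ∑ b, a x k b * curv G l k x j b := by
    simp only [Matrix.mul_apply, Matrix.transpose_apply]
  have hs : ∑ k, ((curv G l k x * a x) k j + (a x * (curv G l k x)ᵀ) k j)
      = ∑ k, wedgeSymm (covVec G v x) (coordVec l) (coordVec k) k j :=
    Finset.sum_congr rfl fun k _ => h k
  have o : (1 : Matrix (Fin n) (Fin n) ℝ) l j = (1 : Matrix (Fin n) (Fin n) ℝ) j l := by
    simp [Matrix.one_apply, eq_comm]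
  simp only [hw, Finset.sum_add_distrib, Finset.sum_sub_distrib, ← Finset.sum_mul, e1, e2] at hs
  have f1 : ∑ k, covVec G v x k l * (1 : Matrix (Fin n) (Fin n) ℝ) k j = covVec G v x j l := by
    simp [Matrix.one_apply]
  have f2 : ∑ k, (1 : Matrix (Fin n) (Fin n) ℝ) k l * covVec G v x j k = covVec G v x j l := by
    simp [Matrix.one_apply]
  rw [f1, f2, o, Finset.sum_const, Finset.card_univ, Fintype.card_fin, nsmul_eq_mul] at hs
  simp only [Matrix.trace, Matrix.diag_apply]
  linarith

/-- The covariant differential `∇ v` is self-adjoint. -/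
theorem metric_mul_covVec_symm (H : EinsteinGeodesicSystem U G g a v c) (hn : n ≠ 0) (hx : x ∈ U) :
    (g x * covVec G v x)ᵀ = g x * covVec G v x := by
  have hn' : (n : ℝ) ≠ 0 := by exact_mod_cast hn
  have e : ∀ p l, n * (g x * covVec G v x) p l = (covVec G v x).trace * g x p l
      - c * (g x * a x * g x) p l + ∑ k, ∑ b, a x k b * (g x * curv G l k x) p b := by
    intro p l
    have h1 : ∑ j, g x p j * (1 : Matrix (Fin n) (Fin n) ℝ) j l = g x p l := by
      rw [← Matrix.mul_apply, Matrix.mul_one]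
    have h2 : ∑ j, g x p j * ∑ k, ∑ b, a x k b * curv G l k x j b
        = ∑ k, ∑ b, a x k b * (g x * curv G l k x) p b := by
      simp only [Matrix.mul_apply, Finset.mul_sum]
      rw [Finset.sum_comm]
      refine Finset.sum_congr rfl fun k _ => ?_
      rw [Finset.sum_comm]
      exact Finset.sum_congr rfl fun b _ => Finset.sum_congr rfl fun j _ => by ring
    rw [Matrix.mul_assoc, Matrix.mul_apply, Matrix.mul_apply (M := g x), ← h1, ← h2,
      Finset.mul_sum, Finset.mul_sum, Finset.mul_sum, ← Finset.sum_sub_distrib,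
      ← Finset.sum_add_distrib]
    refine Finset.sum_congr rfl fun j _ => ?_
    linear_combination g x p j * H.trace_curv_sol hx j l
  ext p l
  rw [Matrix.transpose_apply]
  apply mul_left_cancel₀ hn'
  have hg : g x l p = g x p l := congrFun (congrFun (H.metric_symm x hx) p) l
  have hgag : (g x * a x * g x) l p = (g x * a x * g x) p l := by
    have : (g x * a x * g x)ᵀ = g x * a x * g x := by
      rw [transpose_mul, transpose_mul, H.metric_symm x hx, H.sol_symm x hx, Matrix.mul_assoc]
    exact congrFun (congrFun this p) l
  rw [e, e, hg, hgag]
  congr 1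
  rw [Finset.sum_comm]
  refine Finset.sum_congr rfl fun k _ => Finset.sum_congr rfl fun b _ => ?_
  rw [H.curv_pair_symm hx l k p b, show a x b k = a x k b from
    congrFun (congrFun (H.sol_symm x hx) k) b]

theorem metric_mul_covEnd_symm (H : EinsteinGeodesicSystem U G g a v c) (hn : n ≠ 0) (hx : x ∈ U)
    (m : Fin n) :
    (g x * covEnd G m (covVec G v) x)ᵀ = g x * covEnd G m (covVec G v) x := by
  have hg1 : MatContDiffOn 1 g U := H.metric_contDiff.of_le (by norm_num)
  have e : g x * covEnd G m (covVec G v) x = mpd m (fun y => g y * covVec G v y) x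
      - (G m x)ᵀ * (g x * covVec G v x) - (g x * covVec G v x) * G m x := by
    rw [mpd_mul H.isOpen hx hg1 H.covVec_contDiff, H.compat m x hx]
    simp only [covEnd, Matrix.mul_add, Matrix.add_mul, Matrix.mul_sub, Matrix.mul_assoc]
    abel
  have hs : (mpd m (fun y => g y * covVec G v y) x)ᵀ = mpd m (fun y => g y * covVec G v y) x := by
    rw [← mpd_transpose]
    exact mpd_congr H.isOpen hx (fun y hy => H.metric_mul_covVec_symm hn hy) m
  rw [e, transpose_sub, transpose_sub, hs, transpose_mul, transpose_mul _ (G m x),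
    H.metric_mul_covVec_symm hn hx, transpose_transpose]
  abel

end EinsteinGeodesicSystem

namespace EinsteinGeodesicSystem

open Matrix

variable {n : ℕ} {U : Set (Fin n → ℝ)} {x : Fin n → ℝ} {c : ℝ}
  {G : Fin n → (Fin n → ℝ) → Matrix (Fin n) (Fin n) ℝ}
  {g a : (Fin n → ℝ) → Matrix (Fin n) (Fin n) ℝ} {v : (Fin n → ℝ) → Matrix (Fin n) Unit ℝ}

theorem trace_curv_mul_vec (H : EinsteinGeodesicSystem U G g a v c) (hx : x ∈ U) (l : Fin n) :
    ∑ k, (curv G k l x * v x) k () = c * (g x * v x) l () := by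
  simp only [Matrix.mul_apply]
  rw [Finset.sum_comm, Finset.mul_sum]
  refine Finset.sum_congr rfl fun b _ => ?_
  rw [← Finset.sum_mul, H.einstein b l x hx,
    show g x b l = g x l b from congrFun (congrFun (H.metric_symm x hx) l) b]
  ring

/-- The differentiated integrability condition, with indices lowered and contracted. -/
theorem contracted_covCurv_sol (H : EinsteinGeodesicSystem U G g a v c) (hx : x ∈ U)
    {h : Matrix (Fin n) (Fin n) ℝ} (hs : hᵀ = h) (hg : h * g x = 1) (p q k : Fin n) :
    (g x * (curv G q k x * v x)) p () + (g x * (curv G p k x * v x)) q ()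
      - c * (g x p k * (g x * v x) q () + g x q k * (g x * v x) p ())
      = (∑ m, ∑ l, h m l * (g x * covEnd G m (covVec G v) x) p l) * g x k q
        + g x p k * (∑ m, ∑ l, h m l * (g x * covEnd G m (covVec G v) x) q l)
        - (g x * covEnd G q (covVec G v) x) p k - (g x * covEnd G p (covVec G v) x) q k := by
  have gs := H.metric_symm x hx
  have gsy : ∀ i j, g x i j = g x j i := fun i j => congrFun (congrFun gs j) i
  have hsy : ∀ i j, h i j = h j i := fun i j => congrFun (congrFun hs j) i
  have hgd : ∀ i j, ∑ k, h i k * g x k j = if i = j then 1 else 0 := fun i j => by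
    rw [← Matrix.mul_apply, hg, Matrix.one_apply]
  have hlow : ∀ m l, (g x * covCurv G m l k x * (a x * g x)) p q
      + (g x * covCurv G m l k x * (a x * g x)) q p
      + (g x * (curv G l k x * v x)) p () * g x m q + (g x * curv G l k x) p m * (g x * v x) q ()
      + (g x * (curv G l k x * v x)) q () * g x m p + (g x * curv G l k x) q m * (g x * v x) p ()
      = (g x * covEnd G m (covVec G v) x) p l * g x k q
        + g x p k * (g x * covEnd G m (covVec G v) x) q l
        - (g x * covEnd G m (covVec G v) x) p k * g x l q
        - g x p l * (g x * covEnd G m (covVec G v) x) q k := by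
    intro m l
    have e := covCurv_mul_solution H.isOpen hx H.conn_contDiff H.conn_symm H.sol_contDiff
      H.vec_contDiff H.sol_eq m l k
    have e' := congrArg (fun M => (g x * M * g x) p q) e
    simp only [wedgeSymm_coordVec_apply, gs] at e'
    rw [← e']
    have o : ∀ (A B : Matrix (Fin n) Unit ℝ) (i j : Fin n), (A * Bᵀ) i j = A i () * B j () := by
      intro A B i j
      simp [Matrix.mul_apply]
    have o1 : ∀ i j, (g x * (curv G l k x * v x)) i () * g x m j
        = (g x * (curv G l k x * v x) * (g x * coordVec m)ᵀ) i j := fun i j => by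
      rw [o, mul_coordVec_apply, gsy]
    have o2 : ∀ i j, (g x * curv G l k x) i m * (g x * v x) j ()
        = (g x * curv G l k x * coordVec m * (g x * v x)ᵀ) i j := fun i j => by
      rw [o, mul_coordVec_apply]
    have tr : ∀ (M : Matrix (Fin n) (Fin n) ℝ), M q p = Mᵀ p q := fun M => rfl
    rw [o1, o1, o2, o2, tr (_ * (a x * g x)), tr (_ * (g x * coordVec m)ᵀ), tr (_ * (g x * v x)ᵀ)]
    simp only [← Matrix.add_apply]
    refine congrFun (congrFun ?_ p) q
    simp only [transpose_mul, transpose_transpose, gs, H.sol_symm x hx, Matrix.mul_add,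
      Matrix.add_mul, Matrix.mul_assoc]
    abel
  have hdiv : ∀ p q, ∑ m, ∑ l, h m l * (g x * covCurv G m l k x * (a x * g x)) p q = 0 := by
    intro p q
    have e : ∀ b, ∑ m, ∑ l, h m l * (g x * covCurv G m l k x) p b = 0 := fun b =>
      divergence_covCurv H.isOpen hx H.conn_contDiff H.conn_symm H.metric_contDiff H.metric_symm
        H.compat H.einstein hg p b k
    calc _ = ∑ m, ∑ l, ∑ b, h m l * (g x * covCurv G m l k x) p b * (a x * g x) b q := by
          refine Finset.sum_congr rfl fun m _ => Finset.sum_congr rfl fun l _ => ?_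
          rw [Matrix.mul_apply, Finset.mul_sum]
          exact Finset.sum_congr rfl fun b _ => by ring
      _ = ∑ b, (∑ m, ∑ l, h m l * (g x * covCurv G m l k x) p b) * (a x * g x) b q := by
          simp only [Finset.sum_mul]
          rw [Finset.sum_comm' (t' := Finset.univ) (s' := fun _ => Finset.univ) (by simp)]
          conv_rhs => rw [Finset.sum_comm]
          conv_lhs => rw [Finset.sum_comm]
          refine Finset.sum_congr rfl fun m _ => ?_
          rw [Finset.sum_comm]
      _ = 0 := by simp [e]
  have hT : ∀ p q, ∑ m, ∑ l, h m l * ((g x * (curv G l k x * v x)) p () * g x m q)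
      = (g x * (curv G q k x * v x)) p () := by
    intro p q
    rw [Finset.sum_comm]
    have : ∀ l, ∑ m, h m l * ((g x * (curv G l k x * v x)) p () * g x m q)
        = if l = q then (g x * (curv G l k x * v x)) p () else 0 := fun l => by
      calc _ = (∑ m, h l m * g x m q) * (g x * (curv G l k x * v x)) p () := by
            rw [Finset.sum_mul]
            exact Finset.sum_congr rfl fun m _ => by rw [hsy]; ring
        _ = _ := by rw [hgd]; simp
    simp [this]
  have hR : ∀ p, ∑ m, ∑ l, h m l * (g x * curv G l k x) p m = - c * g x p k := by
    intro p
    rw [Finset.sum_comm]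
    have : ∀ l, ∑ m, h m l * (g x * curv G l k x) p m = - curv G l k x l p := fun l => by
      calc _ = - (h * (g x * curv G l k x)) l p := by
            rw [Matrix.mul_apply, ← Finset.sum_neg_distrib]
            exact Finset.sum_congr rfl fun m _ => by rw [hsy, H.curv_skew hx]; ring
        _ = _ := by rw [← Matrix.mul_assoc, hg, Matrix.one_mul]
    simp only [this, Finset.sum_neg_distrib, H.einstein p k x hx]
    ring
  have hS : ∀ p q, ∑ m, ∑ l, h m l * ((g x * covEnd G m (covVec G v) x) p k * g x l q)
      = (g x * covEnd G q (covVec G v) x) p k := by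
    intro p q
    have : ∀ m, ∑ l, h m l * ((g x * covEnd G m (covVec G v) x) p k * g x l q)
        = if m = q then (g x * covEnd G m (covVec G v) x) p k else 0 := fun m => by
      calc _ = (∑ l, h m l * g x l q) * (g x * covEnd G m (covVec G v) x) p k := by
            rw [Finset.sum_mul]
            exact Finset.sum_congr rfl fun l _ => by ring
        _ = _ := by rw [hgd]; simp
    simp [this]
  rw [← hT p q, ← hT q p, ← hS p q, ← hS q p]
  have d1 := hdiv p q
  have d2 := hdiv q p
  have r1 : c * (g x p k * (g x * v x) q ())
      = - ∑ m, ∑ l, h m l * ((g x * curv G l k x) p m * (g x * v x) q ()) := by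
    simp only [← mul_assoc, ← Finset.sum_mul, hR]
    ring
  have r2 : c * (g x q k * (g x * v x) p ())
      = - ∑ m, ∑ l, h m l * ((g x * curv G l k x) q m * (g x * v x) p ()) := by
    simp only [← mul_assoc, ← Finset.sum_mul, hR]
    ring
  have hsum : ∑ m, ∑ l, h m l * ((g x * covCurv G m l k x * (a x * g x)) p q
      + (g x * covCurv G m l k x * (a x * g x)) q p
      + (g x * (curv G l k x * v x)) p () * g x m q + (g x * curv G l k x) p m * (g x * v x) q ()
      + (g x * (curv G l k x * v x)) q () * g x m p + (g x * curv G l k x) q m * (g x * v x) p ())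
      = ∑ m, ∑ l, h m l * ((g x * covEnd G m (covVec G v) x) p l * g x k q
        + g x p k * (g x * covEnd G m (covVec G v) x) q l
        - (g x * covEnd G m (covVec G v) x) p k * g x l q
        - (g x * covEnd G m (covVec G v) x) q k * g x l p) :=
    Finset.sum_congr rfl fun m _ => Finset.sum_congr rfl fun l _ => by
      rw [hlow, gsy p l, mul_comm (g x l p)]
  have s1 : (∑ m, ∑ l, h m l * (g x * covEnd G m (covVec G v) x) p l) * g x k q
      = ∑ m, ∑ l, h m l * ((g x * covEnd G m (covVec G v) x) p l * g x k q) := by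
    simp only [← mul_assoc, ← Finset.sum_mul]
  have s2 : g x p k * (∑ m, ∑ l, h m l * (g x * covEnd G m (covVec G v) x) q l)
      = ∑ m, ∑ l, h m l * (g x p k * (g x * covEnd G m (covVec G v) x) q l) := by
    simp only [Finset.mul_sum]
    exact Finset.sum_congr rfl fun m _ => Finset.sum_congr rfl fun l _ => by ring
  simp only [mul_add, mul_sub, Finset.sum_add_distrib, Finset.sum_sub_distrib] at hsum
  rw [s1, s2, mul_add, r1, r2]
  linarith

theorem covEnd_covVec_and_curv (H : EinsteinGeodesicSystem U G g a v c) (hn : 2 ≤ n) {K : ℝ}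
    (hK : c = (n - 1) * K) (hx : x ∈ U) (p q k : Fin n) :
    (g x * covEnd G p (covVec G v) x) q k = - K * (2 * (g x * v x) p () * g x q k
        + (g x * v x) q () * g x p k + (g x * v x) k () * g x p q)
      ∧ (g x * (curv G q k x * v x)) p ()
        = K * (g x p q * (g x * v x) k () - g x p k * (g x * v x) q ()) := by
  have gs := H.metric_symm x hx
  have hg : (g x)⁻¹ * g x = 1 := Matrix.nonsing_inv_mul _ (H.metric_isUnit x hx)
  have hs : ((g x)⁻¹)ᵀ = (g x)⁻¹ := by rw [transpose_nonsing_inv, gs]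
  have hsy : ∀ i j, (g x)⁻¹ i j = (g x)⁻¹ j i := fun i j => congrFun (congrFun hs j) i
  refine solve_contracted_prolongation (h := (g x)⁻¹) hs gs hg
    (T := fun p q k => (g x * (curv G q k x * v x)) p ())
    (S := fun p q k => (g x * covEnd G p (covVec G v) x) q k) (w := fun p => (g x * v x) p ())
    (D := fun p => ∑ m, ∑ l, (g x)⁻¹ m l * (g x * covEnd G m (covVec G v) x) p l) hn
    ?_ ?_ ?_ (fun _ => rfl) ?_ ?_ p q k
  · intro p q k
    simp only [curv_antisymm q k, Matrix.neg_mul, Matrix.mul_neg, Matrix.neg_apply]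
  · exact fun p q k =>
      congrFun (congrFun (H.metric_mul_covEnd_symm (by lia) hx p) k) q
  · intro l
    rw [← hK, ← H.trace_curv_mul_vec hx l, Finset.sum_comm]
    refine Finset.sum_congr rfl fun k _ => ?_
    calc _ = ((g x)⁻¹ * (g x * (curv G k l x * v x))) k () := by
          rw [Matrix.mul_apply]
          exact Finset.sum_congr rfl fun j _ => by rw [hsy]
      _ = _ := by rw [← Matrix.mul_assoc, hg, Matrix.one_mul]
  · intro p q k
    rw [← hK]
    exact H.contracted_covCurv_sol hx hs hg p q k
  · intro j k l
    rw [curv_mul_vec H.isOpen hx H.conn_contDiff_one H.conn_symm H.vec_contDiff, Matrix.mul_sub,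
      Matrix.sub_apply, ← Matrix.mul_assoc, ← Matrix.mul_assoc, mul_coordVec_apply,
      mul_coordVec_apply]

end EinsteinGeodesicSystem

namespace EinsteinGeodesicSystem

open Matrix

variable {n : ℕ} {U : Set (Fin n → ℝ)} {x : Fin n → ℝ} {c K : ℝ}
  {G : Fin n → (Fin n → ℝ) → Matrix (Fin n) (Fin n) ℝ}
  {g a : (Fin n → ℝ) → Matrix (Fin n) (Fin n) ℝ} {v : (Fin n → ℝ) → Matrix (Fin n) Unit ℝ}

theorem mul_transpose_unit_apply {p q : Type*} (A : Matrix p Unit ℝ) (B : Matrix q Unit ℝ) (i : p)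
    (j : q) : (A * Bᵀ) i j = A i () * B j () := by
  simp [Matrix.mul_apply]

theorem metric_mul_cancel (H : EinsteinGeodesicSystem U G g a v c) (hx : x ∈ U)
    {A B : Matrix (Fin n) (Fin n) ℝ} (h : g x * A = g x * B) : A = B := by
  rw [← Matrix.one_mul A, ← Matrix.one_mul B,
    ← Matrix.nonsing_inv_mul _ (H.metric_isUnit x hx), Matrix.mul_assoc, h, ← Matrix.mul_assoc]

theorem covEnd_covVec (H : EinsteinGeodesicSystem U G g a v c) (hn : 2 ≤ n)
    (hK : c = (n - 1) * K) (hx : x ∈ U) (m : Fin n) :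
    covEnd G m (covVec G v) x = (-2 * K * (g x * v x) m ()) • (1 : Matrix (Fin n) (Fin n) ℝ)
      - K • ((v x * (coordVec m)ᵀ + coordVec m * (v x)ᵀ) * g x) := by
  have gs := H.metric_symm x hx
  refine H.metric_mul_cancel hx ?_
  ext q k
  rw [(H.covEnd_covVec_and_curv hn hK hx m q k).1]
  have e1 : (g x * (v x * (coordVec m)ᵀ * g x)) q k = (g x * v x) q () * g x m k := by
    have : g x * (v x * (coordVec m)ᵀ * g x) = g x * v x * (g x * coordVec m)ᵀ := by
      rw [transpose_mul, gs]
      simp only [Matrix.mul_assoc]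
    rw [this, mul_transpose_unit_apply, mul_coordVec_apply]
    exact congrArg _ (congrFun (congrFun gs m) k)
  have e2 : (g x * (coordVec m * (v x)ᵀ * g x)) q k = g x m q * (g x * v x) k () := by
    have : g x * (coordVec m * (v x)ᵀ * g x) = g x * coordVec m * (g x * v x)ᵀ := by
      rw [transpose_mul, gs]
      simp only [Matrix.mul_assoc]
    rw [this, mul_transpose_unit_apply, mul_coordVec_apply]
    exact congrArg (· * _) (congrFun (congrFun gs m) q)
  rw [Matrix.mul_sub, Matrix.mul_smul, Matrix.mul_smul, Matrix.mul_one, Matrix.add_mul,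
    Matrix.mul_add, Matrix.sub_apply, Matrix.smul_apply, Matrix.smul_apply, Matrix.add_apply, e1,
    e2, smul_eq_mul, smul_eq_mul]
  ring

/-- The endomorphism field `∇ v + K a g`. -/
def shifted (G : Fin n → (Fin n → ℝ) → Matrix (Fin n) (Fin n) ℝ)
    (g a : (Fin n → ℝ) → Matrix (Fin n) (Fin n) ℝ) (v : (Fin n → ℝ) → Matrix (Fin n) Unit ℝ)
    (K : ℝ) (x : Fin n → ℝ) : Matrix (Fin n) (Fin n) ℝ :=
  covVec G v x + K • (a x * g x)

theorem shifted_contDiff (H : EinsteinGeodesicSystem U G g a v c) (K : ℝ) :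
    MatContDiffOn 1 (shifted G g a v K) U :=
  H.covVec_contDiff.add (MatContDiffOn.smul contDiffOn_const
    ((H.sol_contDiff.of_le (by norm_num)).mul (H.metric_contDiff.of_le (by norm_num))))

theorem covEnd_shifted (H : EinsteinGeodesicSystem U G g a v c) (hn : 2 ≤ n)
    (hK : c = (n - 1) * K) (hx : x ∈ U) (m : Fin n) :
    covEnd G m (shifted G g a v K) x
      = (-2 * K * (g x * v x) m ()) • (1 : Matrix (Fin n) (Fin n) ℝ) := by
  have ha : MatContDiffOn 1 a U := H.sol_contDiff.of_le (by norm_num)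
  have hg : MatContDiffOn 1 g U := H.metric_contDiff.of_le (by norm_num)
  have hm : mpd m (shifted G g a v K) x = mpd m (covVec G v) x
      + K • (mpd m a x * g x + a x * mpd m g x) := by
    unfold shifted
    rw [mpd_add H.isOpen hx H.covVec_contDiff (MatContDiffOn.smul contDiffOn_const (ha.mul hg)),
      mpd_smul (differentiableAt_const K) H.isOpen hx (ha.mul hg), pd_const, zero_smul, zero_add,
      mpd_mul H.isOpen hx ha hg]
  have h1 := H.covEnd_covVec hn hK hx m
  have h2 : mpd m a x * g x + a x * mpd m g x + G m x * (a x * g x) - a x * g x * G m x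
      = (v x * (coordVec m)ᵀ + coordVec m * (v x)ᵀ) * g x := by
    rw [← H.sol_eq m x hx, H.compat m x hx]
    simp only [Matrix.mul_add, Matrix.add_mul, Matrix.mul_assoc]
    abel
  rw [← h2] at h1
  calc _ = covEnd G m (covVec G v) x + K • (mpd m a x * g x + a x * mpd m g x
        + G m x * (a x * g x) - a x * g x * G m x) := by
        rw [covEnd, hm]
        simp only [covEnd, shifted, Matrix.mul_add, Matrix.add_mul, smul_add, smul_sub,
          Matrix.mul_smul, Matrix.smul_mul]
        abel
    _ = _ := by rw [h1, sub_add_cancel]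

theorem pd_trace_shifted (H : EinsteinGeodesicSystem U G g a v c) (hn : 2 ≤ n)
    (hK : c = (n - 1) * K) (hx : x ∈ U) (m : Fin n) :
    pd m (fun y => (shifted G g a v K y).trace / n) x = -2 * K * (g x * v x) m () := by
  have hn' : (n : ℝ) ≠ 0 := by
    have : n ≠ 0 := by lia
    exact_mod_cast this
  have hd : ∀ i, DifferentiableAt ℝ (fun y => shifted G g a v K y i i) x := fun i =>
    (H.shifted_contDiff K).diff H.isOpen le_rfl hx i i
  have e : pd m (fun y => (shifted G g a v K y).trace / n) x
      = (mpd m (shifted G g a v K) x).trace / n := by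
    simp only [Matrix.trace, Matrix.diag_apply, div_eq_inv_mul]
    rw [pd_const_mul _ (by fun_prop), pd_sum (F := fun i y => shifted G g a v K y i i) _
      fun i _ => hd i]
    rfl
  have t := congrArg Matrix.trace (H.covEnd_shifted hn hK hx m)
  rw [covEnd, trace_sub, trace_add, trace_mul_comm (G m x), add_sub_cancel_right, trace_smul,
    trace_one, Fintype.card_fin, smul_eq_mul] at t
  rw [e, t]
  field_simp

/-- The trace-free part of `∇ v + K a g`. -/
def traceFree (G : Fin n → (Fin n → ℝ) → Matrix (Fin n) (Fin n) ℝ)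
    (g a : (Fin n → ℝ) → Matrix (Fin n) (Fin n) ℝ) (v : (Fin n → ℝ) → Matrix (Fin n) Unit ℝ)
    (K : ℝ) (x : Fin n → ℝ) : Matrix (Fin n) (Fin n) ℝ :=
  shifted G g a v K x - ((shifted G g a v K x).trace / n) • 1

theorem contDiffOn_trace_shifted (H : EinsteinGeodesicSystem U G g a v c) (K : ℝ) :
    ContDiffOn ℝ 1 (fun y => (shifted G g a v K y).trace / n) U :=
  (ContDiffOn.sum fun i _ => H.shifted_contDiff K i i).div_const _

theorem traceFree_contDiff (H : EinsteinGeodesicSystem U G g a v c) (K : ℝ) :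
    MatContDiffOn 1 (traceFree G g a v K) U :=
  (H.shifted_contDiff K).sub (MatContDiffOn.smul (H.contDiffOn_trace_shifted K)
    (matContDiffOn_const 1))

/-- The trace-free part of `∇ v + K a g` is parallel. -/
theorem mpd_traceFree (H : EinsteinGeodesicSystem U G g a v c) (hn : 2 ≤ n)
    (hK : c = (n - 1) * K) (hx : x ∈ U) (m : Fin n) :
    mpd m (traceFree G g a v K) x
      = traceFree G g a v K x * G m x - G m x * traceFree G g a v K x := by
  have hc := H.contDiffOn_trace_shifted K
  have h1 := H.covEnd_shifted hn hK hx m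
  have h2 : mpd m (traceFree G g a v K) x = mpd m (shifted G g a v K) x
      - (-2 * K * (g x * v x) m ()) • (1 : Matrix (Fin n) (Fin n) ℝ) := by
    unfold traceFree
    rw [mpd_sub H.isOpen hx (H.shifted_contDiff K) (MatContDiffOn.smul hc (matContDiffOn_const 1)),
      mpd_smul (differentiableAt_of_contDiffOn H.isOpen hc le_rfl hx) H.isOpen hx
        (matContDiffOn_const 1), mpd_const, smul_zero, add_zero, H.pd_trace_shifted hn hK hx]
  rw [h2, ← h1]
  simp only [covEnd, traceFree, Matrix.sub_mul, Matrix.mul_sub, Matrix.smul_mul, Matrix.mul_smul,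
    Matrix.one_mul, Matrix.mul_one]
  abel

theorem sum_smul_coordVec (u : Matrix (Fin n) Unit ℝ) : ∑ l, u l () • coordVec l = u := by
  ext i j
  simp [Matrix.sum_apply, coordVec]

theorem wedgeSymm_shifted (H : EinsteinGeodesicSystem U G g a v c) (hn : 2 ≤ n)
    (hK : c = (n - 1) * K) (hx : x ∈ U) (k : Fin n) :
    wedgeSymm (shifted G g a v K x) (v x) (coordVec k) = 0 := by
  have gs := H.metric_symm x hx
  have hQ : ∑ l, v x l () • curv G l k x
      = K • (v x * (coordVec k)ᵀ * g x - coordVec k * (v x)ᵀ * g x) := by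
    refine H.metric_mul_cancel hx ?_
    ext p b
    have e1 : (g x * ∑ l, v x l () • curv G l k x) p b = - (g x * (curv G p b x * v x)) k () := by
      rw [Matrix.mul_sum, Matrix.sum_apply, ← Matrix.mul_assoc, Matrix.mul_apply,
        ← Finset.sum_neg_distrib]
      refine Finset.sum_congr rfl fun l _ => ?_
      rw [Matrix.mul_smul, Matrix.smul_apply, smul_eq_mul, H.curv_pair_symm hx p b l k,
        H.curv_skew hx l k p b]
      ring
    have e2 : g x * K • (v x * (coordVec k)ᵀ * g x - coordVec k * (v x)ᵀ * g x)
        = K • (g x * v x * (g x * coordVec k)ᵀ - g x * coordVec k * (g x * v x)ᵀ) := by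
      simp only [transpose_mul, gs, Matrix.mul_smul, Matrix.mul_sub, Matrix.mul_assoc]
    rw [e1, e2, (H.covEnd_covVec_and_curv hn hK hx k p b).2, Matrix.smul_apply, Matrix.sub_apply,
      mul_transpose_unit_apply, mul_transpose_unit_apply, mul_coordVec_apply, mul_coordVec_apply,
      show g x p k = g x k p from congrFun (congrFun gs k) p,
      show g x b k = g x k b from congrFun (congrFun gs k) b, smul_eq_mul]
    ring
  have hs : (∑ l, v x l () • curv G l k x) * a x + a x * (∑ l, v x l () • curv G l k x)ᵀ
      = wedgeSymm (covVec G v x) (v x) (coordVec k) := by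
    conv_rhs => rw [← sum_smul_coordVec (v x), ← sum_smul_wedgeSymm_left]
    simp only [Matrix.mul_sum, Matrix.sum_mul, transpose_sum, Matrix.mul_smul,
      Matrix.smul_mul, transpose_smul, ← Finset.sum_add_distrib, ← smul_add, H.curv_sol hx]
  rw [hQ] at hs
  calc _ = wedgeSymm (covVec G v x) (v x) (coordVec k)
      - (K • (v x * (coordVec k)ᵀ * g x - coordVec k * (v x)ᵀ * g x) * a x
        + a x * (K • (v x * (coordVec k)ᵀ * g x - coordVec k * (v x)ᵀ * g x))ᵀ) := by
        simp only [wedgeSymm, shifted, transpose_mul, transpose_sub, transpose_add,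
          transpose_smul, gs, H.sol_symm x hx, transpose_transpose, Matrix.mul_smul,
          Matrix.smul_mul, Matrix.mul_add, Matrix.add_mul, Matrix.mul_sub, Matrix.sub_mul,
          smul_sub, Matrix.mul_assoc]
        abel
    _ = 0 := by rw [hs, sub_self]

/-- An endomorphism `N` with `Nv ⊙ e_k = v ⊙ Ne_k` for all `k` is a multiple of the identity. -/
theorem eq_smul_one_of_wedgeSymm_eq_zero {N : Matrix (Fin n) (Fin n) ℝ}
    {u : Matrix (Fin n) Unit ℝ} (hu : u ≠ 0)
    (h : ∀ k, wedgeSymm N u (coordVec k) = 0) : N = (N.trace / n) • 1 := by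
  obtain ⟨i₀, hi₀⟩ : ∃ i, u i () ≠ 0 := by
    by_contra! hc
    exact hu (by ext i j; exact hc i)
  have hn' : (n : ℝ) ≠ 0 := by
    have : n ≠ 0 := by
      rintro rfl
      exact i₀.elim0
    exact_mod_cast this
  have he : ∀ i j k, (N * u) i () * (if j = k then 1 else 0)
      + (if i = k then 1 else 0) * (N * u) j () - N i k * u j () - u i () * N j k = 0 := by
    intro i j k
    have := congrFun (congrFun (h k) i) j
    simpa only [wedgeSymm, Matrix.add_apply, Matrix.sub_apply, mul_transpose_unit_apply,
      mul_coordVec_apply, coordVec, Matrix.zero_apply] using this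
  have hNu : ∀ j, (N * u) j () = N.trace / n * u j () := by
    intro j
    have hs : ∑ k, ((N * u) k () * (if j = k then 1 else 0)
        + (if k = k then 1 else 0) * (N * u) j () - N k k * u j () - u k () * N j k) = 0 :=
      Finset.sum_eq_zero fun k _ => he k j k
    have e : ∑ k, u k () * N j k = (N * u) j () := by
      rw [Matrix.mul_apply]
      exact Finset.sum_congr rfl fun k _ => mul_comm _ _
    have e' : ∑ k, N k k * u j () = N.trace * u j () := by
      rw [← Finset.sum_mul]
      rfl
    rw [Finset.sum_sub_distrib, Finset.sum_sub_distrib, Finset.sum_add_distrib, e, e'] at hs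
    simp only [mul_ite, mul_one, mul_zero, Finset.sum_ite_eq, Finset.mem_univ, if_true, one_mul,
      Finset.sum_const, Finset.card_univ, Fintype.card_fin, nsmul_eq_mul] at hs
    field_simp
    linarith
  set t := N.trace / n
  have hz : ∀ k, N i₀ k = t * (if i₀ = k then 1 else 0) := by
    intro k
    have := he i₀ i₀ k
    rw [hNu] at this
    apply mul_left_cancel₀ hi₀
    linarith
  ext j k
  have := he i₀ j k
  rw [hNu, hNu, hz] at this
  rw [Matrix.smul_apply, Matrix.one_apply, smul_eq_mul]
  apply mul_left_cancel₀ hi₀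
  linarith

theorem traceFree_eq_zero_of_ne_zero (H : EinsteinGeodesicSystem U G g a v c) (hn : 2 ≤ n)
    (hK : c = (n - 1) * K) (hx : x ∈ U) (hv : v x ≠ 0) : traceFree G g a v K x = 0 :=
  sub_eq_zero.mpr (eq_smul_one_of_wedgeSymm_eq_zero hv (H.wedgeSymm_shifted hn hK hx))

end EinsteinGeodesicSystem

section Uniqueness

open Matrix

/-- A function whose derivative is locally bounded by a multiple of its norm and which vanishes
at one point of a connected open set vanishes identically there. -/
theorem eq_zero_of_norm_fderiv_le {E W : Type*} [NormedAddCommGroup E] [NormedSpace ℝ E]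
    [NormedAddCommGroup W] [NormedSpace ℝ W] {U : Set E} (hU : IsOpen U) (hUc : IsPreconnected U)
    {F : E → W} (hF : ∀ y ∈ U, DifferentiableAt ℝ F y) {C : E → ℝ} (hC : ContinuousOn C U)
    (hb : ∀ y ∈ U, ∀ w, ‖fderiv ℝ F y w‖ ≤ C y * ‖w‖ * ‖F y‖) {x₀ : E} (hx₀ : x₀ ∈ U)
    (h0 : F x₀ = 0) : ∀ y ∈ U, F y = 0 := by
  have hopen : IsOpen {y | y ∈ U ∧ F y = 0} := by
    rw [Metric.isOpen_iff]
    rintro p ⟨hpU, hp0⟩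
    obtain ⟨r, hr, hball⟩ := Metric.isOpen_iff.mp hU p hpU
    refine ⟨r, hr, fun y hy => ⟨hball hy, ?_⟩⟩
    have hγ : ∀ t ∈ Set.Icc (0 : ℝ) 1, AffineMap.lineMap p y t ∈ U := fun t ht =>
      hball ((convex_ball p r).lineMap_mem (Metric.mem_ball_self hr) hy ht)
    have hγc : Continuous (AffineMap.lineMap p y : ℝ → E) := AffineMap.lineMap_continuous
    obtain ⟨B, hB⟩ := isCompact_Icc.exists_bound_of_continuousOn
      (hC.comp hγc.continuousOn hγ : ContinuousOn (C ∘ AffineMap.lineMap p y) (Set.Icc (0 : ℝ) 1))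
    have hder : ∀ t ∈ Set.Icc (0 : ℝ) 1, HasDerivAt (fun s : ℝ => F (AffineMap.lineMap p y s))
        (fderiv ℝ F (AffineMap.lineMap p y t) (y - p)) t := fun t ht =>
      (hF _ (hγ t ht)).hasFDerivAt.comp_hasDerivAt t AffineMap.hasDerivAt_lineMap
    have hg := norm_le_gronwallBound_of_norm_deriv_right_le (a := 0) (b := 1) (δ := 0)
      (K := B * ‖y - p‖) (ε := 0) (f := fun s : ℝ => F (AffineMap.lineMap p y s))
      (fun t ht => (hder t ht).continuousAt.continuousWithinAt)
      (fun t ht => (hder t (Set.Ico_subset_Icc_self ht)).hasDerivWithinAt)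
      (by simp [hp0])
      (fun t ht => by
        have ht' := Set.Ico_subset_Icc_self ht
        refine (hb _ (hγ t ht') _).trans ?_
        rw [add_zero]
        have := (le_abs_self _).trans (hB t ht')
        exact mul_le_mul_of_nonneg_right (mul_le_mul_of_nonneg_right this (norm_nonneg _))
          (norm_nonneg _)) 1 (by simp)
    simpa [gronwallBound_ε0] using hg
  have hsub := hUc.subset_of_closure_inter_subset hopen ⟨x₀, hx₀, hx₀, h0⟩ (by
    rintro y ⟨hy, hyU⟩
    refine ⟨hyU, ?_⟩
    have hcl : y ∈ closure (U ∩ {y | F y = 0}) := hy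
    by_contra hne
    have hnhds : {z | F z ≠ 0} ∈ nhds y :=
      ((hF y hyU).continuousAt).eventually_ne hne
    obtain ⟨z, hz, hz'⟩ := mem_closure_iff_nhds.mp hcl _ hnhds
    exact hz hz'.2)
  exact fun y hy => (hsub hy).2

variable {n : ℕ} {U : Set (Fin n → ℝ)}
  {G : Fin n → (Fin n → ℝ) → Matrix (Fin n) (Fin n) ℝ}

/-- A parallel field of endomorphisms vanishing at one point vanishes identically. -/
theorem eq_zero_of_parallel (hU : IsOpen U) (hUc : IsPreconnected U)
    (hG : ∀ k, MatContDiffOn 1 (G k) U) {τ : (Fin n → ℝ) → Matrix (Fin n) (Fin n) ℝ}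
    (hτ : MatContDiffOn 1 τ U) (h : ∀ m, ∀ y ∈ U, mpd m τ y = τ y * G m y - G m y * τ y)
    {x₀ : Fin n → ℝ} (hx₀ : x₀ ∈ U) (h0 : τ x₀ = 0) : ∀ y ∈ U, τ y = 0 := by
  let F : (Fin n → ℝ) → Fin n → Fin n → ℝ := fun y i j => τ y i j
  let s : (Fin n → ℝ) → ℝ := fun y => ∑ k, ∑ i, ∑ j, |G k y i j|
  have hτd : ∀ y ∈ U, ∀ i j, DifferentiableAt ℝ (fun z => τ z i j) y := fun y hy i j =>
    hτ.diff hU le_rfl hy i j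
  have hF : ∀ y ∈ U, DifferentiableAt ℝ F y := fun y hy =>
    differentiableAt_pi.mpr fun i => differentiableAt_pi.mpr fun j => hτd y hy i j
  have hs : ContinuousOn s U := continuousOn_finsetSum _ fun k _ => continuousOn_finsetSum _
    fun i _ => continuousOn_finsetSum _ fun j _ => (hG k i j).continuousOn.abs
  have hsG : ∀ k i j y, |G k y i j| ≤ s y := by
    intro k i j y
    calc |G k y i j| ≤ ∑ j, |G k y i j| :=
          Finset.single_le_sum (f := fun j => |G k y i j|) (fun _ _ => abs_nonneg _)
            (Finset.mem_univ j)
      _ ≤ ∑ i, ∑ j, |G k y i j| :=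
          Finset.single_le_sum (f := fun i => ∑ j, |G k y i j|)
            (fun _ _ => Finset.sum_nonneg fun _ _ => abs_nonneg _) (Finset.mem_univ i)
      _ ≤ s y :=
          Finset.single_le_sum (f := fun k => ∑ i, ∑ j, |G k y i j|)
            (fun _ _ => Finset.sum_nonneg fun _ _ => Finset.sum_nonneg fun _ _ => abs_nonneg _)
            (Finset.mem_univ k)
  have hs0 : ∀ y, 0 ≤ s y := fun y => Finset.sum_nonneg fun _ _ => Finset.sum_nonneg fun _ _ =>
    Finset.sum_nonneg fun _ _ => abs_nonneg _
  have hFτ : ∀ i j y, |τ y i j| ≤ ‖F y‖ := fun i j y =>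
    (norm_le_pi_norm (F y i) j).trans (norm_le_pi_norm (F y) i)
  have hb : ∀ y ∈ U, ∀ w, ‖fderiv ℝ F y w‖ ≤ (2 * n * n * s y) * ‖w‖ * ‖F y‖ := by
    intro y hy w
    have hr : 0 ≤ (2 * n * n * s y) * ‖w‖ * ‖F y‖ := by
      have := hs0 y
      positivity
    refine (pi_norm_le_iff_of_nonneg hr).mpr fun i => (pi_norm_le_iff_of_nonneg hr).mpr fun j => ?_
    have e : fderiv ℝ F y w i j = ∑ k, w k * (τ y * G k y - G k y * τ y) i j := by
      have e1 : fderiv ℝ F y w i j = fderiv ℝ (fun z => τ z i j) y w := by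
        rw [fderiv_pi fun i => differentiableAt_pi.mpr fun j => hτd y hy i j]
        simp only [ContinuousLinearMap.pi_apply]
        rw [fderiv_pi fun j => hτd y hy i j]
        rfl
      rw [e1, fderiv_apply_eq_sum_pd]
      refine Finset.sum_congr rfl fun k _ => ?_
      rw [← h k y hy]
      rfl
    have hm : ∀ k, |(τ y * G k y - G k y * τ y) i j| ≤ 2 * n * (‖F y‖ * s y) := by
      intro k
      rw [Matrix.sub_apply, Matrix.mul_apply, Matrix.mul_apply, ← Finset.sum_sub_distrib]
      refine (Finset.abs_sum_le_sum_abs _ _).trans ?_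
      have : ∀ l ∈ Finset.univ, |τ y i l * G k y l j - G k y i l * τ y l j| ≤
          2 * (‖F y‖ * s y) := by
        intro l _
        refine (abs_sub _ _).trans ?_
        rw [abs_mul, abs_mul]
        have h1 := mul_le_mul (hFτ i l y) (hsG k l j y) (abs_nonneg _) (norm_nonneg _)
        have h2 := mul_le_mul (hsG k i l y) (hFτ l j y) (abs_nonneg _) (hs0 y)
        linarith
      refine (Finset.sum_le_card_nsmul _ _ _ this).trans (le_of_eq ?_)
      rw [Finset.card_univ, Fintype.card_fin, nsmul_eq_mul]
      ring
    rw [e, Real.norm_eq_abs]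
    refine (Finset.abs_sum_le_sum_abs _ _).trans ?_
    have : ∀ k ∈ Finset.univ, |w k * (τ y * G k y - G k y * τ y) i j| ≤
        ‖w‖ * (2 * n * (‖F y‖ * s y)) := by
      intro k _
      rw [abs_mul]
      exact mul_le_mul (norm_le_pi_norm w k) (hm k) (abs_nonneg _) (norm_nonneg _)
    refine (Finset.sum_le_card_nsmul _ _ _ this).trans (le_of_eq ?_)
    rw [Finset.card_univ, Fintype.card_fin, nsmul_eq_mul]
    ring
  have h0' : F x₀ = 0 := by
    ext i j
    exact congrFun (congrFun h0 i) j
  intro y hy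
  ext i j
  exact congrFun (congrFun (eq_zero_of_norm_fderiv_le hU hUc hF (by fun_prop) hb hx₀ h0' y hy) i) j

end Uniqueness

section DetInverse

open Matrix

variable {n : ℕ} {m : Type*} [Fintype m] [DecidableEq m] {U : Set (Fin n → ℝ)} {x : Fin n → ℝ}
  {r : WithTop ℕ∞} {M : (Fin n → ℝ) → Matrix m m ℝ}

theorem MatContDiffOn.det (hM : MatContDiffOn r M U) : ContDiffOn ℝ r (fun y => (M y).det) U := by
  simp only [Matrix.det_apply]
  exact ContDiffOn.sum fun σ _ => (contDiffOn_prod fun i _ => hM (σ i) i).const_smul _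

theorem MatContDiffOn.inv (hM : MatContDiffOn r M U) (hdet : ∀ y ∈ U, IsUnit (M y).det) :
    MatContDiffOn r (fun y => (M y)⁻¹) U := by
  intro i j
  have hadj : ContDiffOn ℝ r (fun y => (M y).adjugate i j) U := by
    simp only [Matrix.adjugate_apply]
    refine MatContDiffOn.det (M := fun y => (M y).updateRow j (Pi.single i 1)) fun a b => ?_
    simp only [Matrix.updateRow_apply]
    split_ifs
    · exact contDiffOn_const
    · exact hM a b
  have h := (hM.det.inv fun y hy => (hdet y hy).ne_zero).mul hadj
  refine h.congr fun y _ => ?_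
  change (M y)⁻¹ i j = ((M y).det)⁻¹ * (M y).adjugate i j
  rw [Matrix.inv_def, Matrix.smul_apply, Ring.inverse_eq_inv', smul_eq_mul]

theorem mpd_inv (hU : IsOpen U) (hx : x ∈ U) (hM : MatContDiffOn 1 M U)
    (hdet : ∀ y ∈ U, IsUnit (M y).det) (k : Fin n) :
    mpd k (fun y => (M y)⁻¹) x = - ((M x)⁻¹ * mpd k M x * (M x)⁻¹) := by
  have h := mpd_congr hU hx (fun y hy => Matrix.nonsing_inv_mul (M y) (hdet y hy)) k
  rw [mpd_mul hU hx (hM.inv hdet) hM, mpd_const] at h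
  rw [← Matrix.mul_one (mpd k (fun y => (M y)⁻¹) x), ← Matrix.mul_nonsing_inv _ (hdet x hx),
    ← Matrix.mul_assoc, eq_neg_of_add_eq_zero_left h, Matrix.neg_mul]

/-- Jacobi's formula. -/
theorem pd_det (hU : IsOpen U) (hx : x ∈ U) (hM : MatContDiffOn 1 M U)
    (hdet : ∀ y ∈ U, IsUnit (M y).det) (k : Fin n) :
    pd k (fun y => (M y).det) x = (M x).det * ((M x)⁻¹ * mpd k M x).trace := by
  let f : ContinuousMultilinearMap ℝ (fun _ : m => m → ℝ) ℝ :=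
    ⟨(Matrix.detRowAlternating (R := ℝ) (n := m)).toMultilinearMap,
      Continuous.matrix_det continuous_id⟩
  have hrow : ∀ i, DifferentiableAt ℝ (fun y => M y i) x := fun i =>
    differentiableAt_pi.mpr fun j => hM.diff hU le_rfl hx i j
  have hd : HasFDerivAt (fun y => (M y).det) _ x :=
    HasFDerivAt.multilinear_comp (f := f) fun i => (hrow i).hasFDerivAt
  have hsum : pd k (fun y => (M y).det) x = ∑ i, ((M x).updateRow i (mpd k M x i)).det := by
    rw [pd, hd.fderiv, _root_.sum_apply]
    refine Finset.sum_congr rfl fun i _ => ?_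
    have e : fderiv ℝ (fun y => M y i) x (Pi.single k 1) = mpd k M x i := by
      rw [fderiv_pi fun j => hM.diff hU le_rfl hx i j]
      rfl
    rw [ContinuousLinearMap.comp_apply, e]
    rfl
  have hadj : (M x).adjugate = (M x).det • (M x)⁻¹ := by
    rw [Matrix.inv_def, smul_smul, Ring.mul_inverse_cancel _ (hdet x hx), one_smul]
  rw [hsum, ← smul_eq_mul, ← Matrix.trace_smul, ← Matrix.smul_mul, ← hadj, Matrix.trace_mul_comm]
  refine Finset.sum_congr rfl fun i _ => ?_
  rw [← Matrix.cramer_transpose_apply, Matrix.cramer_eq_adjugate_mulVec, ← adjugate_transpose,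
    Matrix.diag_apply, Matrix.mul_apply]
  exact Finset.sum_congr rfl fun j _ => mul_comm _ _

theorem pd_log_det (hU : IsOpen U) (hx : x ∈ U) (hM : MatContDiffOn 1 M U)
    (hdet : ∀ y ∈ U, IsUnit (M y).det) (k : Fin n) :
    pd k (fun y => Real.log (M y).det) x = ((M x)⁻¹ * mpd k M x).trace := by
  have hne : (M x).det ≠ 0 := (hdet x hx).ne_zero
  have hd := differentiableAt_of_contDiffOn hU hM.det le_rfl hx
  have h := pd_det hU hx hM hdet k
  rw [pd] at h ⊢
  rw [fderiv.log hd hne, _root_.smul_apply, h, smul_eq_mul,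
    inv_mul_cancel_left₀ hne]

end DetInverse

section LeviCivita

open Matrix

variable {n : ℕ} {U : Set (Fin n → ℝ)} {x : Fin n → ℝ}
  {g : Fin n → Fin n → (Fin n → ℝ) → ℝ}

/-- The connection matrices `Γ_k = (Γ^i_{kj})_{ij}` of a metric. -/
def connection (g : Fin n → Fin n → (Fin n → ℝ) → ℝ) (k : Fin n) (x : Fin n → ℝ) :
    Matrix (Fin n) (Fin n) ℝ :=
  Matrix.of fun i j => Christoffel g i k j x

theorem IsMetric.matContDiffOn {r : WithTop ℕ∞} (hg : IsMetric r g U) :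
    MatContDiffOn r (matAt g) U := hg.contDiff

theorem IsMetric.transpose_matAt {r : WithTop ℕ∞} (hg : IsMetric r g U) (hx : x ∈ U) :
    (matAt g x)ᵀ = matAt g x := by
  ext i j
  exact hg.symm j i x hx

theorem connection_contDiff {r s : WithTop ℕ∞} (hU : IsOpen U) (hg : IsMetric s g U)
    (hrs : r + 1 ≤ s) (k : Fin n) : MatContDiffOn r (connection g k) U := by
  intro i j
  have hpd : ∀ a b c, ContDiffOn ℝ r (pd a (g b c)) U := fun a b c =>
    contDiffOn_pd hU (hg.contDiff b c) hrs a
  have hinv : ∀ b, ContDiffOn ℝ r (ginv g i b) U := fun b =>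
    ((hg.matContDiffOn.inv hg.inv) i b).of_le (le_self_add.trans hrs)
  exact contDiffOn_const.mul (ContDiffOn.sum fun b _ =>
    (hinv b).mul (((hpd k j b).add (hpd j k b)).sub (hpd b k j)))

theorem connection_symm {r : WithTop ℕ∞} (hU : IsOpen U) (hg : IsMetric r g U) (i j k : Fin n)
    (hx : x ∈ U) : connection g k x i j = connection g j x i k := by
  simp only [connection, Matrix.of_apply, Christoffel]
  congr 1
  refine Finset.sum_congr rfl fun b _ => ?_
  rw [pd_congr hU hx (hg.symm k j) b]
  ring

theorem matAt_mul_connection {r : WithTop ℕ∞} (hg : IsMetric r g U) (hx : x ∈ U) (i j k : Fin n) :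
    (matAt g x * connection g k x) i j
      = (1 / 2) * (pd k (g j i) x + pd j (g k i) x - pd i (g k j) x) := by
  have e : connection g k x = (matAt g x)⁻¹ * Matrix.of fun b j =>
      (1 / 2) * (pd k (g j b) x + pd j (g k b) x - pd b (g k j) x) := by
    ext i j
    rw [Matrix.mul_apply]
    simp only [connection, Matrix.of_apply, Christoffel, ginv, Finset.mul_sum]
    exact Finset.sum_congr rfl fun b _ => by ring
  rw [e, ← Matrix.mul_assoc, Matrix.mul_nonsing_inv _ (hg.inv x hx), Matrix.one_mul,
    Matrix.of_apply]

theorem mpd_matAt {r : WithTop ℕ∞} (hU : IsOpen U) (hg : IsMetric r g U) (hx : x ∈ U)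
    (k : Fin n) :
    mpd k (matAt g) x = (connection g k x)ᵀ * matAt g x + matAt g x * connection g k x := by
  have e : (connection g k x)ᵀ * matAt g x = (matAt g x * connection g k x)ᵀ := by
    rw [transpose_mul, hg.transpose_matAt hx]
  ext i j
  rw [e, Matrix.add_apply, Matrix.transpose_apply, matAt_mul_connection hg hx,
    matAt_mul_connection hg hx, pd_congr hU hx (hg.symm j i) k]
  simp only [mpd, Matrix.of_apply, matAt]
  ring

theorem ricci_eq_trace_curv (hU : IsOpen U) (hg : IsMetric 3 g U) (hx : x ∈ U) (i j : Fin n) :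
    Ricci g i j x = ∑ a, curv (connection g) a j x a i := by
  have hs : ∀ h a b, ∀ y ∈ U, Christoffel g h a b y = Christoffel g h b a y := fun h a b y hy =>
    connection_symm hU hg h b a hy
  have hd : ∀ a, DifferentiableAt ℝ (fun y => Christoffel g a i a y) x := fun a =>
    (connection_contDiff (r := 2) hU hg (by norm_num) i).diff hU (by norm_num) hx a a
  have h1 : ∀ a, mpd a (connection g j) x a i = pd a (Christoffel g a i j) x := fun a =>
    pd_congr hU hx (hs a j i) a
  have h2 : ∀ a, mpd j (connection g a) x a i = pd j (Christoffel g a i a) x := fun a =>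
    pd_congr hU hx (hs a a i) j
  have h3 : ∀ a, (connection g a x * connection g j x) a i
      = ∑ b, Christoffel g a a b x * Christoffel g b i j x := fun a => by
    rw [Matrix.mul_apply]
    exact Finset.sum_congr rfl fun b _ => by rw [hs b i j x hx]; rfl
  have h4 : ∀ a, (connection g j x * connection g a x) a i
      = ∑ b, Christoffel g a j b x * Christoffel g b i a x := fun a => by
    rw [Matrix.mul_apply]
    exact Finset.sum_congr rfl fun b _ => by rw [hs b i a x hx]; rfl
  simp only [curv, Matrix.sub_apply, Matrix.add_apply, Finset.sum_sub_distrib,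
    Finset.sum_add_distrib, h1, h2, h3, h4]
  rw [Ricci, pd_sum (F := fun a y => Christoffel g a i a y) _ fun a _ => hd a]

theorem pd_log_det_matAt (hU : IsOpen U) (hg : IsMetric 3 g U) (hx : x ∈ U) (k : Fin n) :
    pd k (fun y => Real.log (matAt g y).det) x = 2 * (connection g k x).trace := by
  have hu := hg.inv x hx
  rw [pd_log_det hU hx (hg.matContDiffOn.of_le (by norm_num)) hg.inv, mpd_matAt hU hg hx,
    Matrix.mul_add, trace_add, ← Matrix.mul_assoc, trace_mul_comm, ← Matrix.mul_assoc,
    Matrix.mul_nonsing_inv _ hu, Matrix.one_mul, trace_transpose, ← Matrix.mul_assoc,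
    Matrix.nonsing_inv_mul _ hu, Matrix.one_mul]
  ring

end LeviCivita

section ProjectiveChange

open Matrix

variable {n : ℕ} {U : Set (Fin n → ℝ)} {x : Fin n → ℝ}
  {G Gbar : Fin n → (Fin n → ℝ) → Matrix (Fin n) (Fin n) ℝ}
  {P : (Fin n → ℝ) → Matrix (Fin n) Unit ℝ}

/-- The covector `Φ_k = -∇_k P + P_k P` by which the curvature changes under the projective change
of connection given by the covector field `P`. -/
def projectiveSchouten (G : Fin n → (Fin n → ℝ) → Matrix (Fin n) (Fin n) ℝ)
    (P : (Fin n → ℝ) → Matrix (Fin n) Unit ℝ) (k : Fin n) (x : Fin n → ℝ) :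
    Matrix (Fin n) Unit ℝ :=
  - mpd k P x + (G k x)ᵀ * P x + P x k () • P x

theorem transpose_mul_coordVec (u : Matrix (Fin n) Unit ℝ) (k : Fin n) :
    uᵀ * coordVec k = u k () • (1 : Matrix Unit Unit ℝ) := by
  ext i j
  rw [mul_coordVec_apply]
  simp

theorem coordVec_transpose_mul (u : Matrix (Fin n) Unit ℝ) (k : Fin n) :
    (coordVec k)ᵀ * u = u k () • (1 : Matrix Unit Unit ℝ) := by
  rw [← transpose_transpose ((coordVec k)ᵀ * u), transpose_mul, transpose_transpose,
    transpose_mul_coordVec, transpose_smul, transpose_one]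

theorem curv_projective_change (hU : IsOpen U) (hx : x ∈ U) (hG : ∀ k, MatContDiffOn 1 (G k) U)
    (hsymm : ∀ i j k, ∀ y ∈ U, G k y i j = G j y i k) (hP : MatContDiffOn 1 P U)
    (hPsymm : ∀ k l, mpd k P x l () = mpd l P x k ())
    (h : ∀ k, ∀ y ∈ U, Gbar k y = G k y + P y k () • 1 + coordVec k * (P y)ᵀ) (k l : Fin n) :
    curv Gbar k l x = curv G k l x + coordVec k * (projectiveSchouten G P l x)ᵀ
      - coordVec l * (projectiveSchouten G P k x)ᵀ := by
  have hm : ∀ i j : Fin n, mpd j (Gbar i) x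
      = mpd j (G i) x + mpd j P x i () • 1 + coordVec i * (mpd j P x)ᵀ := by
    intro i j
    have h1 : MatContDiffOn 1 (fun y => P y i () • (1 : Matrix (Fin n) (Fin n) ℝ)) U :=
      (matContDiffOn_const _).smul (hP i ())
    rw [mpd_congr hU hx (h i) j,
      mpd_add hU hx ((hG i).add h1) ((matContDiffOn_const _).mul hP.transpose),
      mpd_add hU hx (hG i) h1, mpd_mul hU hx (matContDiffOn_const _) hP.transpose,
      mpd_smul (hP.diff hU le_rfl hx i ()) hU hx (matContDiffOn_const _), mpd_const, mpd_const,
      mpd_transpose, Matrix.zero_mul, zero_add, smul_zero, add_zero]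
    rfl
  have hsw : ∀ w : Matrix Unit (Fin n) ℝ,
      G k x * (coordVec l * w) = G l x * (coordVec k * w) := by
    intro w
    have : G k x * coordVec l = G l x * coordVec k := by
      ext i j
      rw [mul_coordVec_apply, mul_coordVec_apply, hsymm i l k x hx]
    rw [← Matrix.mul_assoc, this, Matrix.mul_assoc]
  have hc : ∀ (i : Fin n) (w : Matrix Unit (Fin n) ℝ),
      (P x)ᵀ * (coordVec i * w) = P x i () • w := by
    intro i w
    rw [← Matrix.mul_assoc, transpose_mul_coordVec, Matrix.smul_mul, Matrix.one_mul]
  simp only [curv, hm, h _ x hx, hPsymm k l, projectiveSchouten, transpose_add, transpose_neg,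
    transpose_mul, transpose_transpose, transpose_smul, Matrix.mul_add, Matrix.add_mul,
    Matrix.mul_neg, Matrix.mul_assoc, Matrix.smul_mul, Matrix.mul_smul, Matrix.one_mul,
    Matrix.mul_one, hsw, hc]
  module

theorem trace_curv_projective_change (hU : IsOpen U) (hx : x ∈ U)
    (hG : ∀ k, MatContDiffOn 1 (G k) U)
    (hsymm : ∀ i j k, ∀ y ∈ U, G k y i j = G j y i k) (hP : MatContDiffOn 1 P U)
    (hPsymm : ∀ k l, mpd k P x l () = mpd l P x k ())
    (h : ∀ k, ∀ y ∈ U, Gbar k y = G k y + P y k () • 1 + coordVec k * (P y)ᵀ) (j l : Fin n) :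
    ∑ i, curv Gbar i l x i j
      = ∑ i, curv G i l x i j + ((n : ℝ) - 1) * projectiveSchouten G P l x j () := by
  simp only [curv_projective_change hU hx hG hsymm hP hPsymm h, Matrix.sub_apply, Matrix.add_apply,
    EinsteinGeodesicSystem.mul_transpose_unit_apply, Finset.sum_sub_distrib,
    Finset.sum_add_distrib, coordVec]
  simp
  ring

end ProjectiveChange

namespace EinsteinGeodesicSystem

open Matrix

variable {n : ℕ} {U : Set (Fin n → ℝ)} {x : Fin n → ℝ} {c K : ℝ}
  {G : Fin n → (Fin n → ℝ) → Matrix (Fin n) (Fin n) ℝ}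
  {g a : (Fin n → ℝ) → Matrix (Fin n) (Fin n) ℝ} {v P : (Fin n → ℝ) → Matrix (Fin n) Unit ℝ}

theorem covVec_mul_coordVec_eq_projectiveSchouten (H : EinsteinGeodesicSystem U G g a v c)
    (hP : MatContDiffOn 1 P U) (hv : ∀ y ∈ U, v y = - (a y * P y)) (hx : x ∈ U) (k : Fin n) :
    covVec G v x * coordVec k
      = a x * projectiveSchouten G P k x - ((v x)ᵀ * P x) () () • coordVec k := by
  have ha := H.sol_contDiff.of_le (r' := 1) (by norm_num)
  have hs : coordVec k * ((v x)ᵀ * P x) = ((v x)ᵀ * P x) () () • coordVec k := by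
    ext i j
    simp [Matrix.mul_apply, coordVec]
  have hma : mpd k a x = v x * (coordVec k)ᵀ + coordVec k * (v x)ᵀ - G k x * a x
      - a x * (G k x)ᵀ := by
    rw [← H.sol_eq k x hx]
    abel
  have hc : v x * ((coordVec k)ᵀ * P x) = - (P x k () • (a x * P x)) := by
    rw [coordVec_transpose_mul, Matrix.mul_smul, Matrix.mul_one, hv x hx, smul_neg]
  have hvx : G k x * v x = - (G k x * (a x * P x)) := by rw [hv x hx, Matrix.mul_neg]
  rw [covVec_mul_coordVec, mpd_congr H.isOpen hx hv k, mpd_neg, mpd_mul H.isOpen hx ha hP, hma,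
    hvx, ← hs]
  simp only [projectiveSchouten, Matrix.mul_add, Matrix.add_mul, Matrix.sub_mul, Matrix.mul_neg,
    Matrix.mul_smul, Matrix.mul_assoc, hc]
  abel

theorem sol_mul_projectiveSchouten (H : EinsteinGeodesicSystem U G g a v c)
    (hP : MatContDiffOn 1 P U) (hv : ∀ y ∈ U, v y = - (a y * P y)) (hx : x ∈ U)
    (h0 : traceFree G g a v K x = 0) (k : Fin n) :
    a x * projectiveSchouten G P k x + K • (a x * g x * coordVec k)
      = ((shifted G g a v K x).trace / n + ((v x)ᵀ * P x) () ()) • coordVec k := by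
  have h1 : shifted G g a v K x * coordVec k = ((shifted G g a v K x).trace / n) • coordVec k := by
    conv_lhs => rw [sub_eq_zero.mp h0, Matrix.smul_mul, Matrix.one_mul]
  rw [add_smul, ← h1, shifted, Matrix.add_mul,
    H.covVec_mul_coordVec_eq_projectiveSchouten hP hv hx, Matrix.smul_mul]
  abel

theorem pd_trace_add_pairing (H : EinsteinGeodesicSystem U G g a v c) (hn : 2 ≤ n)
    (hK : c = (n - 1) * K) (hP : MatContDiffOn 1 P U) (hv : ∀ y ∈ U, v y = - (a y * P y))
    (hx : x ∈ U) (h0 : traceFree G g a v K x = 0) (k : Fin n) :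
    pd k (fun y => (shifted G g a v K y).trace / n + ((v y)ᵀ * P y) () ()) x
      = 2 * P x k () * ((shifted G g a v K x).trace / n + ((v x)ᵀ * P x) () ()) := by
  have hv1 := H.vec_contDiff.of_le (r' := 1) (by norm_num)
  have hsP := hv1.transpose.mul hP
  have hμ := differentiableAt_of_contDiffOn H.isOpen (H.contDiffOn_trace_shifted K) le_rfl hx
  have hA := H.sol_mul_projectiveSchouten hP hv hx h0 k
  have hL := H.covVec_mul_coordVec_eq_projectiveSchouten hP hv hx k
  rw [eq_sub_of_add_eq hA, add_smul] at hL
  set μ := (shifted G g a v K x).trace / n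
  set s := ((v x)ᵀ * P x) () () with hs
  have hmv : mpd k v x = μ • coordVec k - K • (a x * g x * coordVec k) - G k x * v x := by
    rw [← add_sub_cancel_right (mpd k v x) (G k x * v x), ← covVec_mul_coordVec, hL]
    abel
  have hmP : mpd k P x = - projectiveSchouten G P k x + (G k x)ᵀ * P x + P x k () • P x := by
    rw [projectiveSchouten]
    abel
  have hgv : (coordVec k)ᵀ * (g x * (a x * P x)) = - ((g x * v x) k () • 1) := by
    rw [coordVec_transpose_mul, hv x hx, Matrix.mul_neg, Matrix.neg_apply, neg_smul, neg_neg]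
  have hvt : (v x)ᵀ = - ((P x)ᵀ * a x) := by
    rw [hv x hx, transpose_neg, transpose_mul, H.sol_symm x hx]
  have hPag : (P x)ᵀ * (a x * (g x * coordVec k)) = - ((g x * v x) k () • 1) := by
    rw [← transpose_transpose ((P x)ᵀ * (a x * (g x * coordVec k)))]
    simp only [transpose_mul, transpose_transpose, H.sol_symm x hx, H.metric_symm x hx,
      Matrix.mul_assoc, hgv, transpose_neg, transpose_smul, transpose_one]
  have hvΦ : (v x)ᵀ * projectiveSchouten G P k x
      = - (((μ + s) * P x k () + K * (g x * v x) k ()) • 1) := by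
    rw [hvt, Matrix.neg_mul, Matrix.mul_assoc, eq_sub_of_add_eq hA, Matrix.mul_sub,
      Matrix.mul_smul, Matrix.mul_smul, transpose_mul_coordVec, Matrix.mul_assoc, hPag]
    module
  have hvP : (v x)ᵀ * P x = s • 1 := by
    ext i j
    simp [hs]
  have hm : mpd k (fun y => (v y)ᵀ * P y) x
      = (2 * (μ + s) * P x k () + 2 * K * (g x * v x) k ()) • (1 : Matrix Unit Unit ℝ) := by
    rw [mpd_mul H.isOpen hx hv1.transpose hP, mpd_transpose, hmv, hmP]
    simp only [transpose_sub, transpose_smul, transpose_mul, H.sol_symm x hx, H.metric_symm x hx,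
      Matrix.sub_mul, Matrix.smul_mul, Matrix.mul_assoc, Matrix.mul_add, Matrix.mul_neg,
      Matrix.mul_smul, coordVec_transpose_mul, hgv, hvΦ, hvP]
    module
  have hps : pd k (fun y => ((v y)ᵀ * P y) () ()) x
      = 2 * (μ + s) * P x k () + 2 * K * (g x * v x) k () := by
    have := congrFun (congrFun hm ()) ()
    simpa [mpd] using this
  rw [pd_add hμ (hsP.diff H.isOpen le_rfl hx () ()), H.pd_trace_shifted hn hK hx, hps]
  ring

end EinsteinGeodesicSystem

section GeodesicMapping

open Matrix

variable {n : ℕ} {U : Set (Fin n → ℝ)} {x : Fin n → ℝ}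
  {g gbar : Fin n → Fin n → (Fin n → ℝ) → ℝ} {ψ : Fin n → (Fin n → ℝ) → ℝ}

/-- The potential `(log |det ḡ| - log |det g|) / (2 (n + 1))` of a geodesic mapping. -/
def geodesicPotential (g gbar : Fin n → Fin n → (Fin n → ℝ) → ℝ) (x : Fin n → ℝ) : ℝ :=
  (2 * ((n : ℝ) + 1))⁻¹ * (Real.log (matAt gbar x).det - Real.log (matAt g x).det)

/-- The gradient of the potential of a geodesic mapping, as a column matrix. -/
def geodesicCovector (g gbar : Fin n → Fin n → (Fin n → ℝ) → ℝ) (x : Fin n → ℝ) :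
    Matrix (Fin n) Unit ℝ :=
  Matrix.of fun k _ => pd k (geodesicPotential g gbar) x

theorem contDiffOn_geodesicPotential {r : WithTop ℕ∞} (hg : IsMetric r g U)
    (hgbar : IsMetric r gbar U) : ContDiffOn ℝ r (geodesicPotential g gbar) U :=
  contDiffOn_const.mul ((hgbar.matContDiffOn.det.log fun y hy => (hgbar.inv y hy).ne_zero).sub
    (hg.matContDiffOn.det.log fun y hy => (hg.inv y hy).ne_zero))

theorem geodesicCovector_contDiff (hU : IsOpen U) (hg : IsMetric 3 g U)
    (hgbar : IsMetric 3 gbar U) : MatContDiffOn 2 (geodesicCovector g gbar) U :=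
  fun k _ => contDiffOn_pd hU (contDiffOn_geodesicPotential hg hgbar) (by norm_num) k

theorem geodesicCovector_apply (hU : IsOpen U) (hg : IsMetric 3 g U) (hgbar : IsMetric 3 gbar U)
    (hgeo : GeodesicallyRelated g gbar ψ U) (hx : x ∈ U) (k : Fin n) :
    geodesicCovector g gbar x k () = ψ k x := by
  have hlog : ∀ {h : Fin n → Fin n → (Fin n → ℝ) → ℝ}, IsMetric 3 h U →
      DifferentiableAt ℝ (fun y => Real.log (matAt h y).det) x := fun hh =>
    differentiableAt_of_contDiffOn hU
      (hh.matContDiffOn.det.log fun y hy => (hh.inv y hy).ne_zero) (by norm_num) hx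
  have htr : (connection gbar k x).trace = (connection g k x).trace + (n + 1) * ψ k x := by
    simp only [Matrix.trace, Matrix.diag_apply, connection, Matrix.of_apply, hgeo _ k _ x hx,
      Finset.sum_add_distrib]
    simp
    ring
  have hn : (n : ℝ) + 1 ≠ 0 := by positivity
  change pd k (fun y => (2 * ((n : ℝ) + 1))⁻¹
    * (Real.log (matAt gbar y).det - Real.log (matAt g y).det)) x = ψ k x
  rw [pd_const_mul _ ((hlog hgbar).fun_sub (hlog hg)), pd_sub (hlog hgbar) (hlog hg),
    pd_log_det_matAt hU hgbar hx, pd_log_det_matAt hU hg hx, htr]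
  field_simp
  ring

theorem connection_of_geodesicallyRelated (hU : IsOpen U) (hg : IsMetric 3 g U)
    (hgbar : IsMetric 3 gbar U) (hgeo : GeodesicallyRelated g gbar ψ U) (hx : x ∈ U) (k : Fin n) :
    connection gbar k x = connection g k x + geodesicCovector g gbar x k () • 1
      + coordVec k * (geodesicCovector g gbar x)ᵀ := by
  ext i j
  simp only [Matrix.add_apply, Matrix.smul_apply, Matrix.one_apply, smul_eq_mul,
    EinsteinGeodesicSystem.mul_transpose_unit_apply,
    geodesicCovector_apply hU hg hgbar hgeo hx, coordVec]
  rw [mul_comm (ite _ _ _) (ψ j x)]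
  exact hgeo i k j x hx

/-- The tensor `a = exp (2 φ) ḡ⁻¹` solving the linear form of the geodesic mapping equations. -/
def geodesicSol (g gbar : Fin n → Fin n → (Fin n → ℝ) → ℝ) (x : Fin n → ℝ) :
    Matrix (Fin n) (Fin n) ℝ :=
  Real.exp (2 * geodesicPotential g gbar x) • (matAt gbar x)⁻¹

theorem pd_exp_two_mul {f : (Fin n → ℝ) → ℝ} (hf : DifferentiableAt ℝ f x) (k : Fin n) :
    pd k (fun y => Real.exp (2 * f y)) x = 2 * pd k f x * Real.exp (2 * f x) := by
  have h := pd_const_mul 2 hf k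
  rw [pd] at h ⊢
  rw [fderiv_exp (hf.const_mul 2), _root_.smul_apply, h, smul_eq_mul]
  ring

theorem geodesicSol_contDiff {r : WithTop ℕ∞} (hg : IsMetric r g U) (hgbar : IsMetric r gbar U) :
    MatContDiffOn r (geodesicSol g gbar) U :=
  (hgbar.matContDiffOn.inv hgbar.inv).smul
    (contDiffOn_const.mul (contDiffOn_geodesicPotential hg hgbar)).exp

theorem geodesicSol_eq (hU : IsOpen U) (hg : IsMetric 3 g U) (hgbar : IsMetric 3 gbar U)
    (hgeo : GeodesicallyRelated g gbar ψ U) (hx : x ∈ U) (k : Fin n) :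
    mpd k (geodesicSol g gbar) x + connection g k x * geodesicSol g gbar x
        + geodesicSol g gbar x * (connection g k x)ᵀ
      = -(geodesicSol g gbar x * geodesicCovector g gbar x) * (coordVec k)ᵀ
        + coordVec k * (-(geodesicSol g gbar x * geodesicCovector g gbar x))ᵀ := by
  have hu := hgbar.inv x hx
  have hφ := differentiableAt_of_contDiffOn hU (contDiffOn_geodesicPotential hg hgbar)
    (by norm_num) hx
  have hM := hgbar.matContDiffOn.of_le (r' := 1) (by norm_num)
  have hinvT : ((matAt gbar x)⁻¹)ᵀ = (matAt gbar x)⁻¹ := by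
    rw [transpose_nonsing_inv, hgbar.transpose_matAt hx]
  have hminv : mpd k (fun y => (matAt gbar y)⁻¹) x
      = -((matAt gbar x)⁻¹ * (connection gbar k x)ᵀ + connection gbar k x * (matAt gbar x)⁻¹) := by
    rw [mpd_inv hU hx hM hgbar.inv, mpd_matAt hU hgbar hx, Matrix.mul_add, Matrix.add_mul,
      ← Matrix.mul_assoc, ← Matrix.mul_assoc, Matrix.mul_assoc _ (matAt gbar x),
      Matrix.mul_nonsing_inv _ hu, Matrix.nonsing_inv_mul _ hu, Matrix.mul_one, Matrix.one_mul]
  have hma : mpd k (geodesicSol g gbar) x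
      = Real.exp (2 * geodesicPotential g gbar x) • (mpd k (fun y => (matAt gbar y)⁻¹) x
        + (2 * geodesicCovector g gbar x k ()) • (matAt gbar x)⁻¹) := by
    change mpd k (fun y => Real.exp (2 * geodesicPotential g gbar y) • (matAt gbar y)⁻¹) x = _
    rw [mpd_smul (hφ.const_mul 2).exp hU hx (hM.inv hgbar.inv), pd_exp_two_mul hφ]
    change (2 * geodesicCovector g gbar x k () * _) • _ + _ = _
    module
  rw [hma, hminv, connection_of_geodesicallyRelated hU hg hgbar hgeo hx, geodesicSol]
  simp only [transpose_add, transpose_neg, transpose_mul, transpose_smul, transpose_one,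
    transpose_transpose, hinvT, Matrix.mul_add, Matrix.add_mul, Matrix.neg_mul, Matrix.mul_neg,
    Matrix.smul_mul, Matrix.mul_smul, Matrix.mul_one, Matrix.one_mul, Matrix.mul_assoc]
  module

theorem einsteinGeodesicSystem_of_geodesicallyRelated (hU : IsOpen U) (hg : IsMetric 3 g U)
    (hgbar : IsMetric 3 gbar U) (hgeo : GeodesicallyRelated g gbar ψ U) {c : ℝ}
    (hc : ∀ i j, ∀ x ∈ U, Ricci g i j x = c * g i j x) :
    EinsteinGeodesicSystem U (connection g) (matAt g) (geodesicSol g gbar)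
      (fun y => -(geodesicSol g gbar y * geodesicCovector g gbar y)) c where
  isOpen := hU
  conn_contDiff := connection_contDiff hU hg (by norm_num)
  conn_symm i j k y hy := connection_symm hU hg i j k hy
  metric_contDiff := hg.matContDiffOn.of_le (by norm_num)
  metric_symm y hy := hg.transpose_matAt hy
  metric_isUnit := hg.inv
  compat k y hy := mpd_matAt hU hg hy k
  einstein j l y hy := by
    rw [← ricci_eq_trace_curv hU hg hy, hc j l y hy]
    rfl
  sol_contDiff := (geodesicSol_contDiff hg hgbar).of_le (by norm_num)
  sol_symm y hy := by
    rw [geodesicSol, transpose_smul, transpose_nonsing_inv, hgbar.transpose_matAt hy]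
  vec_contDiff := (((geodesicSol_contDiff hg hgbar).of_le (by norm_num)).mul
    (geodesicCovector_contDiff hU hg hgbar)).neg
  sol_eq k y hy := geodesicSol_eq hU hg hgbar hgeo hy k

theorem ricci_of_geodesicallyRelated (hU : IsOpen U) (hg : IsMetric 3 g U)
    (hgbar : IsMetric 3 gbar U) (hgeo : GeodesicallyRelated g gbar ψ U) (hx : x ∈ U)
    (j l : Fin n) :
    Ricci gbar j l x = Ricci g j l x + ((n : ℝ) - 1)
      * projectiveSchouten (connection g) (geodesicCovector g gbar) l x j () := by
  rw [ricci_eq_trace_curv hU hgbar hx, ricci_eq_trace_curv hU hg hx]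
  exact trace_curv_projective_change hU hx (connection_contDiff hU hg (by norm_num))
    (fun i j k y hy => connection_symm hU hg i j k hy)
    ((geodesicCovector_contDiff hU hg hgbar).of_le (by norm_num))
    (fun k l => pd_comm hU (contDiffOn_geodesicPotential hg hgbar) (by norm_num) hx k l)
    (fun k y hy => connection_of_geodesicallyRelated hU hg hgbar hgeo hy k) j l

theorem exists_eq_const_of_pd_eq_zero {f : (Fin n → ℝ) → ℝ} (hU : IsOpen U)
    (hUc : IsPreconnected U) (hf : ContDiffOn ℝ 1 f U) (h : ∀ k, ∀ y ∈ U, pd k f y = 0) :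
    ∃ b, ∀ y ∈ U, f y = b := by
  refine hU.exists_is_const_of_fderiv_eq_zero hUc (hf.differentiableOn (by norm_num))
    fun y hy => ?_
  ext1 w
  rw [fderiv_apply_eq_sum_pd, Finset.sum_eq_zero fun k _ => by rw [h k y hy, mul_zero]]
  rfl

end GeodesicMapping

/-- Mikeš' theorem: if an Einstein metric `g ∈ C^3` admits a nontrivial geodesic mapping
onto a metric `ḡ ∈ C^3` on an open connected `U ⊆ ℝⁿ` (`n ≥ 2`), then `ḡ` is Einstein. -/
theorem einstein_geodesic_C3
    {n : ℕ} (hn : 2 ≤ n) (U : Set (Fin n → ℝ)) (hU : IsOpen U) (hUc : IsConnected U)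
    (g gbar : Fin n → Fin n → (Fin n → ℝ) → ℝ)
    (hg : IsMetric 3 g U) (hgbar : IsMetric 3 gbar U)
    (hEin : ∃ c : ℝ, ∀ i j, ∀ x ∈ U, Ricci g i j x = c * g i j x)
    (ψ : Fin n → (Fin n → ℝ) → ℝ) (hψ : ∀ i, ContinuousOn (ψ i) U)
    (hgeo : GeodesicallyRelated g gbar ψ U)
    (hnontriv : ¬ ∀ i, ∀ x ∈ U, ψ i x = 0) :
    ∃ cbar : ℝ, ∀ i j, ∀ x ∈ U, Ricci gbar i j x = cbar * gbar i j x := by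
  obtain ⟨c, hc⟩ := hEin
  have hn' : (n : ℝ) - 1 ≠ 0 := by
    have : (2 : ℝ) ≤ n := by exact_mod_cast hn
    linarith
  set P := geodesicCovector g gbar
  set a := geodesicSol g gbar
  set v : (Fin n → ℝ) → Matrix (Fin n) Unit ℝ := fun y => -(a y * P y)
  obtain ⟨K, hK⟩ : ∃ K : ℝ, c = (n - 1) * K := ⟨c / (n - 1), by field_simp⟩
  have H : EinsteinGeodesicSystem U (connection g) (matAt g) a v c :=
    einsteinGeodesicSystem_of_geodesicallyRelated hU hg hgbar hgeo hc
  have hP1 : MatContDiffOn 1 P U := (geodesicCovector_contDiff hU hg hgbar).of_le (by norm_num)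
  have hφ : ContDiffOn ℝ 1 (geodesicPotential g gbar) U :=
    (contDiffOn_geodesicPotential hg hgbar).of_le (by norm_num)
  have hinv : ∀ y ∈ U, matAt gbar y * a y
      = Real.exp (2 * geodesicPotential g gbar y) • (1 : Matrix (Fin n) (Fin n) ℝ) := by
    intro y hy
    change matAt gbar y * geodesicSol g gbar y = _
    rw [geodesicSol, Matrix.mul_smul, Matrix.mul_nonsing_inv _ (hgbar.inv y hy)]
  have h0 : ∀ y ∈ U,
      EinsteinGeodesicSystem.traceFree (connection g) (matAt g) a v K y = 0 := by
    push Not at hnontriv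
    obtain ⟨i, x₀, hx₀, hne⟩ := hnontriv
    refine eq_zero_of_parallel hU hUc.isPreconnected H.conn_contDiff_one (H.traceFree_contDiff K)
      (fun m y hy => H.mpd_traceFree hn hK hy m) hx₀
      (H.traceFree_eq_zero_of_ne_zero hn hK hx₀ fun hv => hne ?_)
    have h1 : matAt gbar x₀ * (a x₀ * P x₀) = 0 := by
      rw [neg_eq_zero.mp hv, Matrix.mul_zero]
    rw [← Matrix.mul_assoc, hinv x₀ hx₀, Matrix.smul_mul, Matrix.one_mul] at h1
    rw [← geodesicCovector_apply hU hg hgbar hgeo hx₀]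
    change P x₀ i () = 0
    rw [(smul_eq_zero_iff_right (Real.exp_ne_zero _)).mp h1]
    rfl
  set σ : (Fin n → ℝ) → ℝ := fun y =>
    (EinsteinGeodesicSystem.shifted (connection g) (matAt g) a v K y).trace / n
      + ((v y).transpose * P y) () ()
  have hσ : ContDiffOn ℝ 1 σ U := (H.contDiffOn_trace_shifted K).add
    (((H.vec_contDiff.of_le (by norm_num)).transpose.mul hP1) () ())
  have hexp : ContDiffOn ℝ 1 (fun y => Real.exp (2 * -geodesicPotential g gbar y)) U :=
    (contDiffOn_const.mul hφ.neg).exp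
  obtain ⟨ρ, hρ⟩ := exists_eq_const_of_pd_eq_zero hU hUc.isPreconnected (hexp.mul hσ) (by
    intro k y hy
    have hφy := differentiableAt_of_contDiffOn hU hφ le_rfl hy
    rw [pd_mul (differentiableAt_of_contDiffOn hU hexp le_rfl hy)
      (differentiableAt_of_contDiffOn hU hσ le_rfl hy), pd_exp_two_mul hφy.fun_neg,
      H.pd_trace_add_pairing hn hK hP1 (fun _ _ => rfl) hy (h0 y hy), pd_neg]
    change 2 * -P y k () * _ * _ + _ = 0
    ring)
  refine ⟨(n - 1) * ρ, fun j l x hx => ?_⟩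
  have hA := H.sol_mul_projectiveSchouten hP1 (fun _ _ => rfl) hx (h0 x hx) l
  have hB := congrArg (fun M => (matAt gbar x * M) j ()) hA
  simp only [Matrix.mul_add, Matrix.mul_smul, ← Matrix.mul_assoc, hinv x hx, Matrix.smul_mul,
    Matrix.one_mul, Matrix.add_apply, Matrix.smul_apply, mul_coordVec_apply, smul_eq_mul] at hB
  have hσx : σ x = Real.exp (2 * geodesicPotential g gbar x) * ρ := by
    rw [← hρ x hx, ← mul_assoc, ← Real.exp_add]
    simp
  change _ = σ x * gbar j l x at hB
  have hg' : matAt g x j l = g j l x := rfl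
  rw [hσx, hg'] at hB
  have hC : projectiveSchouten (connection g) P l x j () + K * g j l x = ρ * gbar j l x := by
    apply mul_left_cancel₀ (Real.exp_ne_zero (2 * geodesicPotential g gbar x))
    linear_combination hB
  rw [ricci_of_geodesicallyRelated hU hg hgbar hgeo hx, hc j l x hx, hK, mul_assoc (_ - 1) ρ, ← hC]
  ring
end
end

section
/- Let n ≥ 2 and let g, ḡ be pseudo-Riemannian metrics of class C^1 on an open set U ⊆ ℝ^n that are geodesically related via a continuous 1-form ψ. Then the function Ψ = (1/(2(n+1))) · ln| det(ḡ_{ij}) / det(g_{ij}) | is differentiable on U and ψ_i = ∂_i Ψ for each i; in particular ψ is an exact (gradient) 1-form. -/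
noncomputable section
open scoped BigOperators

/-- The function `Ψ = (1/(2(n+1))) ln|det ḡ / det g|`. -/
def PsiFun {n : ℕ} (g gbar : Fin n → Fin n → (Fin n → ℝ) → ℝ) (x : Fin n → ℝ) : ℝ :=
  (1 / (2 * ((n : ℝ) + 1))) * Real.log |(matAt gbar x).det / (matAt g x).det|

open Matrix in
/-- Jacobi formula: the derivative of `det A` is `∑ i j, adj(A)_{ji} dA_{ij}`. -/
theorem HasFDerivAt.matrix_det_of_entries {E ι : Type*} [NormedAddCommGroup E] [NormedSpace ℝ E]
    [Fintype ι] [DecidableEq ι] {A : E → Matrix ι ι ℝ} {A' : ι → ι → E →L[ℝ] ℝ} {x : E}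
    (hA : ∀ i j, HasFDerivAt (fun y => A y i j) (A' i j) x) :
    HasFDerivAt (fun y => (A y).det) (∑ i, ∑ j, (A x).adjugate j i • A' i j) x := by
  let D : ContinuousMultilinearMap ℝ (fun _ : ι => ι → ℝ) ℝ :=
    { (Matrix.detRowAlternating (n := ι) (R := ℝ)).toMultilinearMap with
      cont := Continuous.matrix_det (A := fun M : Matrix ι ι ℝ => M) continuous_id }
  have hrows : HasFDerivAt (F := ι → ι → ℝ) (fun y i j => A y i j)
      (ContinuousLinearMap.pi fun i => ContinuousLinearMap.pi fun j => A' i j) x :=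
    hasFDerivAt_pi.2 fun i => hasFDerivAt_pi.2 fun j => hA i j
  have hdet := (D.hasFDerivAt (fun i j => A x i j)).comp x hrows
  refine hdet.congr_fderiv ?_
  ext v
  simp only [ContinuousLinearMap.comp_apply, ContinuousMultilinearMap.linearDeriv_apply,
    _root_.sum_apply, _root_.smul_apply, smul_eq_mul]
  refine Finset.sum_congr rfl fun i _ => ?_
  change ((A x).updateRow i fun j => A' i j v).det = _
  rw [← cramer_transpose_apply, cramer_eq_adjugate_mulVec, ← adjugate_transpose]
  rfl

theorem ginv_comm {n : ℕ} {g : Fin n → Fin n → (Fin n → ℝ) → ℝ} {x : Fin n → ℝ}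
    (hsymm : ∀ i j, g i j x = g j i x) (i j : Fin n) : ginv g i j x = ginv g j i x := by
  have hT : (matAt g x).transpose = matAt g x := by
    ext i j
    exact hsymm j i
  unfold ginv
  conv_lhs => rw [← hT, ← Matrix.transpose_nonsing_inv]
  rfl

/-- The contraction `Γ^h_{ih} = (1/2) g^{hk} ∂_i g_{hk}`. -/
theorem sum_Christoffel {n : ℕ} {g : Fin n → Fin n → (Fin n → ℝ) → ℝ} {x : Fin n → ℝ}
    (hsymm : ∀ i j, g i j x = g j i x) (i : Fin n) :
    ∑ h, Christoffel g h i h x = (1 / 2) * ∑ h, ∑ k, ginv g h k x * pd i (g h k) x := by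
  have hswap : ∑ h, ∑ k, ginv g h k x * pd h (g i k) x =
      ∑ h, ∑ k, ginv g h k x * pd k (g i h) x := by
    rw [Finset.sum_comm]
    simp only [ginv_comm hsymm]
  simp only [Christoffel, ← Finset.mul_sum, mul_add, mul_sub, Finset.sum_add_distrib,
    Finset.sum_sub_distrib]
  rw [hswap]
  ring

/-- `∂_i ln|det g| = 2 Γ^h_{ih}`, together with the differentiability of `ln|det g|`. -/
theorem IsMetric.differentiableAt_log_det {n : ℕ} {g : Fin n → Fin n → (Fin n → ℝ) → ℝ}
    {U : Set (Fin n → ℝ)} (hg : IsMetric 1 g U) (hU : IsOpen U) {x : Fin n → ℝ} (hx : x ∈ U) :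
    DifferentiableAt ℝ (fun y => Real.log (matAt g y).det) x ∧
      ∀ i, pd i (fun y => Real.log (matAt g y).det) x = 2 * ∑ h, Christoffel g h i h x := by
  have hentry : ∀ i j, HasFDerivAt (fun y => matAt g y i j) (fderiv ℝ (g i j) x) x := fun i j =>
    (((hg.contDiff i j).differentiableOn one_ne_zero).differentiableAt
      (hU.mem_nhds hx)).hasFDerivAt
  have hlog := (HasFDerivAt.matrix_det_of_entries hentry).log (hg.inv x hx).ne_zero
  refine ⟨hlog.differentiableAt, fun i => ?_⟩
  have hsymm : ∀ i j, g i j x = g j i x := fun i j => hg.symm i j x hx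
  rw [sum_Christoffel hsymm, pd, hlog.fderiv]
  simp only [smul_apply, sum_apply, smul_eq_mul,
    Finset.mul_sum]
  refine Finset.sum_congr rfl fun h _ => Finset.sum_congr rfl fun k _ => ?_
  rw [ginv_comm hsymm h k, ginv, Matrix.inv_def, Ring.inverse_eq_inv', Matrix.smul_apply,
    smul_eq_mul, pd]
  ring

/-- For geodesically related metrics the 1-form `ψ` is the gradient of
`Ψ = (1/(2(n+1))) ln|det ḡ / det g|`; in particular `ψ` is exact. -/
theorem psi_is_gradient
    {n : ℕ} (hn : 2 ≤ n) (U : Set (Fin n → ℝ)) (hU : IsOpen U)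
    (g gbar : Fin n → Fin n → (Fin n → ℝ) → ℝ)
    (hg : IsMetric 1 g U) (hgbar : IsMetric 1 gbar U)
    (ψ : Fin n → (Fin n → ℝ) → ℝ) (hψ : ∀ i, ContinuousOn (ψ i) U)
    (hgeo : GeodesicallyRelated g gbar ψ U) :
    ∀ x ∈ U, DifferentiableAt ℝ (PsiFun g gbar) x ∧
      ∀ i, ψ i x = pd i (PsiFun g gbar) x := by
  intro x hx
  obtain ⟨hd, hpd⟩ := hg.differentiableAt_log_det hU hx
  obtain ⟨hd', hpd'⟩ := hgbar.differentiableAt_log_det hU hx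
  have heq : PsiFun g gbar =ᶠ[nhds x] fun y => (1 / (2 * ((n : ℝ) + 1))) *
      (Real.log (matAt gbar y).det - Real.log (matAt g y).det) := by
    filter_upwards [hU.mem_nhds hx] with y hy
    rw [PsiFun, Real.log_abs, Real.log_div (hgbar.inv y hy).ne_zero (hg.inv y hy).ne_zero]
  have hΨ := ((hd'.hasFDerivAt.sub hd.hasFDerivAt).const_mul
    (1 / (2 * ((n : ℝ) + 1)))).congr_of_eventuallyEq heq
  refine ⟨hΨ.differentiableAt, fun i => ?_⟩
  have hsum : ∑ h, Christoffel gbar h i h x =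
      ∑ h, Christoffel g h i h x + ((n : ℝ) + 1) * ψ i x := by
    simp only [hgeo _ _ _ x hx, Finset.sum_add_distrib]
    simp
    ring
  have hpos : (n : ℝ) + 1 ≠ 0 := by positivity
  rw [pd, hΨ.fderiv, smul_apply, sub_apply]
  change ψ i x = _ • (pd i (fun y => Real.log (matAt gbar y).det) x -
    pd i (fun y => Real.log (matAt g y).det) x)
  rw [hpd, hpd', hsum, smul_eq_mul]
  field_simp
  ring
end
end

section
/- Let n ≥ 2 and let g, ḡ be pseudo-Riemannian metrics of class C^1 on an open set U ⊆ ℝ^n, and let ψ = (ψ_i) be continuous functions on U. Then the Christoffel symbols satisfy Γ̄^h_{ij} = Γ^h_{ij} + ψ_i δ^h_j + ψ_j δ^h_i on U if and only if ∂_k ḡ_{ij} − Γ^α_{ki} ḡ_{αj} − Γ^α_{kj} ḡ_{iα} = 2 ψ_k ḡ_{ij} + ψ_i ḡ_{jk} + ψ_j ḡ_{ik} on U for all indices i, j, k (here the left-hand side is the covariant derivative ∇_k ḡ_{ij} of ḡ with respect to the Levi-Civita connection of g). -/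
noncomputable section
open scoped BigOperators

section

variable {n : ℕ} {U : Set (Fin n → ℝ)} {r : WithTop ℕ∞}
  {g : Fin n → Fin n → (Fin n → ℝ) → ℝ} {x : Fin n → ℝ}

theorem IsMetric.pd_symm (hU : IsOpen U) (hg : IsMetric r g U) (hx : x ∈ U) (k i j : Fin n) :
    pd k (g i j) x = pd k (g j i) x := by
  have h : g i j =ᶠ[nhds x] g j i :=
    Filter.eventuallyEq_of_mem (hU.mem_nhds hx) (hg.symm i j)
  simp only [pd, h.fderiv_eq]

theorem IsMetric.christoffel_symm (hU : IsOpen U) (hg : IsMetric r g U) (hx : x ∈ U)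
    (h i j : Fin n) : Christoffel g h i j x = Christoffel g h j i x := by
  simp only [Christoffel]
  congr 1
  refine Finset.sum_congr rfl fun k _ => ?_
  rw [hg.pd_symm hU hx k i j]
  ring

/-- Lowering the upper index of the Christoffel symbols of the second kind gives those of the
first kind. -/
theorem IsMetric.sum_christoffel_mul (hg : IsMetric r g U) (hx : x ∈ U) (i j k : Fin n) :
    ∑ a, Christoffel g a i j x * g a k x
      = (1 / 2) * (pd i (g j k) x + pd j (g i k) x - pd k (g i j) x) := by
  set v : Fin n → ℝ := fun k => (1 / 2) * (pd i (g j k) x + pd j (g i k) x - pd k (g i j) x)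
    with hv
  have hΓ : (fun a => Christoffel g a i j x) = (matAt g x)⁻¹.mulVec v := by
    funext a
    simp only [Christoffel, Matrix.mulVec, dotProduct, hv, Finset.mul_sum, ginv]
    exact Finset.sum_congr rfl fun k _ => by ring
  have hlow : (matAt g x).mulVec (fun a => Christoffel g a i j x) = v := by
    rw [hΓ, Matrix.mulVec_mulVec, Matrix.mul_nonsing_inv _ (hg.inv x hx), Matrix.one_mulVec]
  rw [show (1 / 2) * (pd i (g j k) x + pd j (g i k) x - pd k (g i j) x) = v k from rfl, ← hlow]
  simp only [Matrix.mulVec, dotProduct, matAt, Matrix.of_apply]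
  exact Finset.sum_congr rfl fun a _ => by rw [hg.symm a k x hx, mul_comm]

/-- Nondegeneracy of the metric: a vector is determined by its lowered components. -/
theorem IsMetric.eq_of_sum_mul_eq (hg : IsMetric r g U) (hx : x ∈ U) {v w : Fin n → ℝ}
    (h : ∀ k, ∑ a, v a * g a k x = ∑ a, w a * g a k x) : v = w :=
  Matrix.vecMul_injective_of_isUnit ((Matrix.isUnit_iff_isUnit_det _).2 (hg.inv x hx)) (funext h)

/-- The lowered components of the right-hand side of the Levi-Civita equations. -/
theorem sum_add_delta_mul (Γ : Fin n → ℝ) (p q : ℝ) (i j k : Fin n) :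
    ∑ a, (Γ a + p * (if a = j then (1 : ℝ) else 0) + q * (if a = i then (1 : ℝ) else 0)) * g a k x
      = ∑ a, Γ a * g a k x + p * g j k x + q * g i k x := by
  simp [add_mul, Finset.sum_add_distrib]

end

/-- The Levi-Civita equations `Γ̄^h_{ij} = Γ^h_{ij} + ψ_i δ^h_j + ψ_j δ^h_i` are equivalent to
`∇_k ḡ_{ij} = 2 ψ_k ḡ_{ij} + ψ_i ḡ_{jk} + ψ_j ḡ_{ik}`. -/
theorem levi_civita_equations_equiv
    {n : ℕ} (hn : 2 ≤ n) (U : Set (Fin n → ℝ)) (hU : IsOpen U)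
    (g gbar : Fin n → Fin n → (Fin n → ℝ) → ℝ)
    (hg : IsMetric 1 g U) (hgbar : IsMetric 1 gbar U)
    (ψ : Fin n → (Fin n → ℝ) → ℝ) (hψ : ∀ i, ContinuousOn (ψ i) U) :
    GeodesicallyRelated g gbar ψ U ↔
      ∀ i j k, ∀ x ∈ U,
        pd k (gbar i j) x - (∑ a, Christoffel g a k i x * gbar a j x)
            - (∑ a, Christoffel g a k j x * gbar i a x)
          = 2 * ψ k x * gbar i j x + ψ i x * gbar j k x + ψ j x * gbar i k x := by
  have hright : ∀ x ∈ U, ∀ i j k, ∑ a, Christoffel g a k j x * gbar i a x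
      = ∑ a, Christoffel g a k j x * gbar a i x := fun x hx i j k =>
    Finset.sum_congr rfl fun a _ => by rw [hgbar.symm i a x hx]
  constructor
  · intro H i j k x hx
    have key : ∀ i j k, ∑ a, Christoffel g a i j x * gbar a k x + ψ i x * gbar j k x
        + ψ j x * gbar i k x
        = (1 / 2) * (pd i (gbar j k) x + pd j (gbar i k) x - pd k (gbar i j) x) := by
      intro i j k
      rw [← hgbar.sum_christoffel_mul hx, ← sum_add_delta_mul]
      exact Finset.sum_congr rfl fun a _ => by rw [H a i j x hx]
    rw [hright x hx]
    linarith [key k i j, key k j i, hgbar.pd_symm hU hx k i j, hgbar.pd_symm hU hx i k j,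
      hgbar.pd_symm hU hx j k i, congrArg (ψ k x * ·) (hgbar.symm i j x hx),
      congrArg (ψ i x * ·) (hgbar.symm j k x hx), congrArg (ψ j x * ·) (hgbar.symm i k x hx)]
  · intro H h i j x hx
    refine congrFun (hgbar.eq_of_sum_mul_eq hx (v := fun h => Christoffel gbar h i j x)
      (w := fun h => Christoffel g h i j x + ψ i x * (if h = j then (1 : ℝ) else 0)
        + ψ j x * (if h = i then (1 : ℝ) else 0)) fun k => ?_) h
    have hsymm : ∀ i j k, ∑ a, Christoffel g a i j x * gbar a k x
        = ∑ a, Christoffel g a j i x * gbar a k x := fun i j k =>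
      Finset.sum_congr rfl fun a _ => by rw [hg.christoffel_symm hU hx]
    rw [hgbar.sum_christoffel_mul hx, sum_add_delta_mul]
    have hi := H j k i x hx
    have hj := H i k j x hx
    have hk := H i j k x hx
    rw [hright x hx] at hi hj hk
    rw [hgbar.symm k i x hx] at hi
    rw [hgbar.symm k j x hx, hgbar.symm i j x hx] at hj
    rw [hgbar.symm i j x hx] at hk
    linarith [hsymm i j k, hsymm i k j, hsymm j k i]
end
end

section
/- Let n ≥ 1 and let G and Ḡ be invertible symmetric real n×n matrices. Set Ψ = (1/(2(n+1))) ln|det Ḡ / det G| and define the symmetric matrix A = (a_{ij}) by a_{ij} = e^{2Ψ} ḡ^{αβ} g_{αi} g_{βj} (in matrix form A = e^{2Ψ} G Ḡ^{−1} G, where (ḡ^{ij}) = Ḡ^{−1}). Define Ĝ = (ĝ_{ij}) as the inverse matrix of (g^{iα} g^{jβ} a_{αβ}) = G^{−1} A G^{−1}, and Ψ̂ = (1/2) ln|det Ĝ / det G|. Then Ψ̂ = Ψ and Ḡ = e^{2Ψ̂} Ĝ, i.e., ḡ_{ij} = e^{2Ψ̂} ĝ_{ij}; in particular Ḡ is recovered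 from G and A. -/
noncomputable section

/-- The double contraction `P i a * P j b * A a b` is the congruence `P * A * Pᵀ`. -/
theorem Matrix.sum_sum_mul_mul_eq_mul_mul_transpose {m n R : Type*} [Fintype n] [CommSemiring R]
    (P : Matrix m n R) (A : Matrix n n R) (i j : m) :
    ∑ a, ∑ b, P i a * P j b * A a b = (P * A * P.transpose) i j := by
  simp only [Matrix.mul_apply, Matrix.transpose_apply, Finset.sum_mul]
  rw [Finset.sum_comm]
  exact Finset.sum_congr rfl fun b _ => Finset.sum_congr rfl fun a _ => by ring

/-- Pointwise algebraic recovery of the metric `Ḡ` of a geodesic mapping from `G` and the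
Sinyukov tensor `A = e^{2Ψ} G Ḡ⁻¹ G`: with `Ĝ = (G⁻¹ A G⁻¹)⁻¹` and
`Ψ̂ = (1/2) ln|det Ĝ / det G|` one has `Ψ̂ = Ψ` and `Ḡ = e^{2Ψ̂} Ĝ`. -/
theorem metric_recovered_from_sinyukov_tensor
    {n : ℕ} (hn : 1 ≤ n) (G Gbar : Matrix (Fin n) (Fin n) ℝ)
    (hGsymm : G.IsSymm) (hGbarsymm : Gbar.IsSymm)
    (hG : IsUnit G.det) (hGbar : IsUnit Gbar.det)
    (Ψ : ℝ) (hΨ : Ψ = (1 / (2 * ((n : ℝ) + 1))) * Real.log |Gbar.det / G.det|)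
    (A : Matrix (Fin n) (Fin n) ℝ)
    (hA : ∀ i j, A i j = Real.exp (2 * Ψ) * ∑ a, ∑ b, Gbar⁻¹ a b * G a i * G b j)
    (Ghat : Matrix (Fin n) (Fin n) ℝ)
    (hGhat : Ghat = (Matrix.of fun i j => ∑ a, ∑ b, G⁻¹ i a * G⁻¹ j b * A a b)⁻¹)
    (Ψhat : ℝ) (hΨhat : Ψhat = (1 / 2) * Real.log |Ghat.det / G.det|) :
    Ψhat = Ψ ∧ Gbar = Real.exp (2 * Ψhat) • Ghat := by
  have hA' : A = Real.exp (2 * Ψ) • (G * Gbar⁻¹ * G) := by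
    ext i j
    have h := Matrix.sum_sum_mul_mul_eq_mul_mul_transpose G Gbar⁻¹ i j
    rw [hGsymm.eq] at h
    rw [hA, Matrix.smul_apply, smul_eq_mul, ← h]
    congr 1
    refine Finset.sum_congr rfl fun a _ => Finset.sum_congr rfl fun b _ => ?_
    rw [hGsymm.apply i a, hGsymm.apply j b]
    ring
  have hcontr : (Matrix.of fun i j => ∑ a, ∑ b, G⁻¹ i a * G⁻¹ j b * A a b) =
      Real.exp (2 * Ψ) • Gbar⁻¹ := by
    ext i j
    rw [Matrix.of_apply, Matrix.sum_sum_mul_mul_eq_mul_mul_transpose, hA',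
      Matrix.transpose_nonsing_inv, hGsymm.eq, Matrix.mul_smul, Matrix.smul_mul,
      Matrix.mul_assoc G, Matrix.nonsing_inv_mul_cancel_left _ _ hG,
      Matrix.mul_nonsing_inv_cancel_right _ _ hG]
  have hGhat' : Ghat = Real.exp (-(2 * Ψ)) • Gbar := by
    rw [hGhat, hcontr]
    apply Matrix.inv_eq_left_inv
    rw [Matrix.smul_mul, Matrix.mul_smul, Matrix.mul_nonsing_inv _ hGbar, smul_smul,
      ← Real.exp_add, neg_add_cancel, Real.exp_zero, one_smul]
  have hratio : Gbar.det / G.det ≠ 0 := div_ne_zero hGbar.ne_zero hG.ne_zero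
  have hlog : Real.log |Gbar.det / G.det| = 2 * ((n : ℝ) + 1) * Ψ := by
    rw [hΨ]
    field_simp
  have hΨeq : Ψhat = Ψ := by
    rw [hΨhat, hGhat', Matrix.det_smul, Fintype.card_fin, mul_div_assoc, Real.log_abs,
      Real.log_mul (by positivity) hratio, Real.log_pow, Real.log_exp,
      ← Real.log_abs (Gbar.det / G.det), hlog]
    ring
  refine ⟨hΨeq, ?_⟩
  rw [hΨeq, hGhat', smul_smul, ← Real.exp_add, add_neg_cancel, Real.exp_zero, one_smul]
end
end
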